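/- Set K = K₁⁴ + 2K₁²K₂ + K₁⁴K₂², C_{η,m,T} = ρ^{−1} T^{−1/2} (m^{β−1/2} η^{−1/2} + √K) and D_{η,m,T} = √(ηT). Fix γ > 0, δ ∈ (0,1), and suppose β ∈ [0,1), m is even with m ≥ (16K₁²/ρ²)·log(2n/δ), 0 < η ≤ min{m^β, 4m^{2β−1}/(K₁² + K₂)}, and T ≤ ⌊mρ²/(32 η K₂² log 2)⌋. Then there exists a constant C > 0, depending only on the sub-Gaussian constants A and b of μ₀, such that with probability at least 1 − 3δ over the symmetric random initialization and the i.i.d. sample (x_i, y_i)_{i=1}^n ∼ ν^{⊗n}, the gradient descent iterates satisfy min_{t ∈ {0,…,T−1}} ν({(x, y) : y·f_{Θ^{(t)}}(x) ≤ 0}) ≤ C(1 + e^γ)·C_{η,m,T} + 3√(log(2/δ)/(2n)) + C γ^{−1} m^{1/2−β} D_{η,m,T} (1 + K₁ + K₂) · √( (d/n)·log( n(1 + K₁ + K₂)(log(m/δ) + D_{η,m,T}²) ) ). -/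

import Mathlib

open MeasureTheory Real Finset
open scoped RealInnerProductSpace BigOperators

noncomputable section

/-- Two-layer network `f_Θ(x) = m^{-β} ∑_r a_r σ(θ_rᵀ x)`. -/
def fnet (d m : ℕ) (β : ℝ) (σ : ℝ → ℝ) (a : Fin m → ℝ)
    (Θ : Fin m → EuclideanSpace ℝ (Fin d)) (x : EuclideanSpace ℝ (Fin d)) : ℝ :=
  (m : ℝ) ^ (-β) * ∑ r, a r * σ ⟪Θ r, x⟫

/-- Functional-gradient value `g_Θ(x_i) = -y_i/(1+exp(y_i f_Θ(x_i)))`. -/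
def gval (d m n : ℕ) (β : ℝ) (σ : ℝ → ℝ) (a : Fin m → ℝ)
    (x : Fin n → EuclideanSpace ℝ (Fin d)) (y : Fin n → ℝ)
    (Θ : Fin m → EuclideanSpace ℝ (Fin d)) (i : Fin n) : ℝ :=
  - y i / (1 + Real.exp (y i * fnet d m β σ a Θ (x i)))

/-- Empirical logistic loss `L(Θ)`. -/
def eloss (d m n : ℕ) (β : ℝ) (σ : ℝ → ℝ) (a : Fin m → ℝ)
    (x : Fin n → EuclideanSpace ℝ (Fin d)) (y : Fin n → ℝ)
    (Θ : Fin m → EuclideanSpace ℝ (Fin d)) : ℝ :=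
  (1 / n : ℝ) * ∑ i, Real.log (1 + Real.exp (- y i * fnet d m β σ a Θ (x i)))

/-- `L¹(ν_n)`-norm of the functional gradient. -/
def L1norm (d m n : ℕ) (β : ℝ) (σ : ℝ → ℝ) (a : Fin m → ℝ)
    (x : Fin n → EuclideanSpace ℝ (Fin d)) (y : Fin n → ℝ)
    (Θ : Fin m → EuclideanSpace ℝ (Fin d)) : ℝ :=
  (1 / n : ℝ) * ∑ i, |gval d m n β σ a x y Θ i|

/-- Parameter gradient `∇_Θ L(Θ)`. -/
def gradL (d m n : ℕ) (β : ℝ) (σ : ℝ → ℝ) (a : Fin m → ℝ)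
    (x : Fin n → EuclideanSpace ℝ (Fin d)) (y : Fin n → ℝ)
    (Θ : Fin m → EuclideanSpace ℝ (Fin d)) : Fin m → EuclideanSpace ℝ (Fin d) :=
  fun r => (1 / n : ℝ) • ∑ i,
    (gval d m n β σ a x y Θ i * (a r * (m : ℝ) ^ (-β) * deriv σ ⟪Θ r, x i⟫)) • x i

/-- Squared Euclidean norm of a parameter block `‖Θ‖₂²`. -/
def nsq (d m : ℕ) (Θ : Fin m → EuclideanSpace ℝ (Fin d)) : ℝ := ∑ r, ‖Θ r‖ ^ 2

/-- Euclidean norm of a parameter block `‖Θ‖₂`. -/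
def en2 (d m : ℕ) (Θ : Fin m → EuclideanSpace ℝ (Fin d)) : ℝ := Real.sqrt (nsq d m Θ)

/-- The `(2,1)`-norm `‖Θ‖_{2,1} = ∑_r ‖θ_r‖₂`. -/
def n21 (d m : ℕ) (Θ : Fin m → EuclideanSpace ℝ (Fin d)) : ℝ := ∑ r, ‖Θ r‖

/-- Gradient-descent iterates `Θ^{(t+1)} = Θ^{(t)} - η ∇_Θ L(Θ^{(t)})`. -/
def gdSeq (d m n : ℕ) (β : ℝ) (σ : ℝ → ℝ) (a : Fin m → ℝ)
    (x : Fin n → EuclideanSpace ℝ (Fin d)) (y : Fin n → ℝ) (η : ℝ)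
    (Θ0 : Fin m → EuclideanSpace ℝ (Fin d)) : ℕ → Fin m → EuclideanSpace ℝ (Fin d)
  | 0 => Θ0
  | t + 1 => fun r => gdSeq d m n β σ a x y η Θ0 t r
      - η • gradL d m n β σ a x y (gdSeq d m n β σ a x y η Θ0 t) r

/-- Kernel-smoothing quantity `Q(Θ) = ‖(1/n) ∑_i g_Θ(x_i) ∇_Θ f_Θ(x_i)‖₂²`. -/
def Qker (d m n : ℕ) (β : ℝ) (σ : ℝ → ℝ) (a : Fin m → ℝ)
    (x : Fin n → EuclideanSpace ℝ (Fin d)) (y : Fin n → ℝ)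
    (Θ : Fin m → EuclideanSpace ℝ (Fin d)) : ℝ :=
  nsq d m (fun r => (1 / n : ℝ) • ∑ i,
    (gval d m n β σ a x y Θ i * (a r * (m : ℝ) ^ (-β) * deriv σ ⟪Θ r, x i⟫)) • x i)

/-- Symmetric signs: `a_r = 1` for `r < k`, `a_r = -1` for `r ≥ k` (with `m = 2k`). -/
def symSigns (k : ℕ) : Fin (2 * k) → ℝ := fun r => if (r : ℕ) < k then 1 else -1

/-- Symmetric initialization: `θ^{(0)}_{r+k} = θ^{(0)}_r` (with `m = 2k`). -/
def symInit (d k : ℕ) (ω : Fin k → EuclideanSpace ℝ (Fin d)) :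
    Fin (2 * k) → EuclideanSpace ℝ (Fin d) :=
  fun r => if h : (r : ℕ) < k then ω ⟨r, h⟩ else ω ⟨(r : ℕ) - k, by have := r.isLt; omega⟩

/-- Ramp loss with margin `γ`. -/
def ramp (γ v : ℝ) : ℝ := if v < 0 then 1 else if v ≤ γ then 1 - v / γ else 0

/-- Empirical Rademacher complexity of the ramp-loss class over the ball of radius `D`
around `Θ0`. -/
def rade (d m n : ℕ) (β γ D : ℝ) (σ : ℝ → ℝ) (a : Fin m → ℝ)
    (x : Fin n → EuclideanSpace ℝ (Fin d)) (y : Fin n → ℝ)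
    (Θ0 : Fin m → EuclideanSpace ℝ (Fin d)) : ℝ :=
  (1 / n : ℝ) * (1 / 2 ^ n : ℝ) * ∑ ε : Fin n → Bool,
    sSup {z : ℝ | ∃ Θ : Fin m → EuclideanSpace ℝ (Fin d),
      en2 d m (fun r => Θ r - Θ0 r) ≤ D ∧
      z = ∑ i, (if ε i then (1 : ℝ) else -1) * ramp γ (y i * fnet d m β σ a Θ (x i))}

/-- Neural tangent kernel. -/
def kNTK (d : ℕ) (σ : ℝ → ℝ) (μ₀ : Measure (EuclideanSpace ℝ (Fin d)))
    (x x' : EuclideanSpace ℝ (Fin d)) : ℝ :=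
  ∫ θ, deriv σ ⟪θ, x⟫ * deriv σ ⟪θ, x'⟫ * ⟪x, x'⟫ ∂μ₀

/-- Volume bound on the cardinality of a separated subset of a ball. -/
theorem card_le_of_separated_ball {E : Type*} [NormedAddCommGroup E] [NormedSpace ℝ E]
    [FiniteDimensional ℝ E] {R ε : ℝ} (hR : 0 ≤ R) (hε : 0 < ε) (s : Finset E)
    (hs : ∀ c ∈ s, ‖c‖ ≤ R) (h : ∀ c ∈ s, ∀ d ∈ s, c ≠ d → ε ≤ ‖c - d‖) :
    (s.card : ℝ) ≤ (1 + 2 * R / ε) ^ Module.finrank ℝ E := by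
  borelize E
  let μ : Measure E := Measure.addHaar
  have hδ : 0 < ε / 2 := by positivity
  have hρ : 0 < R + ε / 2 := by positivity
  have D : Set.Pairwise (s : Set E)
      (Function.onFun Disjoint fun c => Metric.ball (c : E) (ε / 2)) := by
    rintro c hc d hd hcd
    apply Metric.ball_disjoint_ball
    rw [dist_eq_norm]
    have := h c hc d hd hcd
    linarith
  have hsub : (⋃ c ∈ s, Metric.ball (c : E) (ε / 2)) ⊆ Metric.ball (0 : E) (R + ε / 2) := by
    refine Set.iUnion₂_subset fun x hx => ?_
    apply Metric.ball_subset_ball'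
    rw [dist_zero_right]
    have := hs x hx
    linarith
  have I : (s.card : ENNReal) * ENNReal.ofReal ((ε / 2) ^ Module.finrank ℝ E)
        * μ (Metric.ball 0 1) ≤
      ENNReal.ofReal ((R + ε / 2) ^ Module.finrank ℝ E) * μ (Metric.ball 0 1) :=
    calc
      _ = μ (⋃ c ∈ s, Metric.ball (c : E) (ε / 2)) := by
        rw [measure_biUnion_finset D fun c _ => measurableSet_ball]
        simp only [μ.addHaar_ball_of_pos _ hδ]
        simp only [Finset.sum_const, nsmul_eq_mul, mul_assoc]
      _ ≤ μ (Metric.ball (0 : E) (R + ε / 2)) := measure_mono hsub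
      _ = _ := by simp only [μ.addHaar_ball_of_pos _ hρ]
  have J := (ENNReal.mul_le_mul_iff_left
    (Metric.measure_ball_pos μ (0 : E) zero_lt_one).ne' measure_ball_lt_top.ne).1 I
  have K := ENNReal.toReal_le_of_le_ofReal (pow_nonneg hρ.le _) J
  rw [ENNReal.toReal_mul, ENNReal.toReal_natCast, ENNReal.toReal_ofReal (by positivity),
    ← le_div_iff₀ (by positivity), ← div_pow] at K
  have e : (R + ε / 2) / (ε / 2) = 1 + 2 * R / ε := by field_simp; ring
  rwa [e] at K

/-- A ball of radius `R` has an `ε`-net of size at most `(1 + 2R/ε)^d`. -/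
theorem exists_finset_net {E : Type*} [NormedAddCommGroup E] [NormedSpace ℝ E]
    [FiniteDimensional ℝ E] {R ε : ℝ} (hR : 0 ≤ R) (hε : 0 < ε) :
    ∃ s : Finset E, s.Nonempty ∧ (s.card : ℝ) ≤ (1 + 2 * R / ε) ^ Module.finrank ℝ E ∧
      (∀ c ∈ s, ‖c‖ ≤ R) ∧ ∀ x : E, ‖x‖ ≤ R → ∃ c ∈ s, ‖x - c‖ ≤ ε := by
  classical
  let P : ℕ → Prop := fun k => ∃ s : Finset E, s.card = k ∧ (∀ c ∈ s, ‖c‖ ≤ R) ∧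
    ∀ c ∈ s, ∀ d ∈ s, c ≠ d → ε ≤ ‖c - d‖
  have hP : ∀ k, P k → k ≤ ⌊(1 + 2 * R / ε) ^ Module.finrank ℝ E⌋₊ := by
    rintro k ⟨s, rfl, h1, h2⟩
    exact Nat.le_floor (card_le_of_separated_ball hR hε s h1 h2)
  have hP0 : P 0 := ⟨∅, by simp⟩
  obtain ⟨s, hs, h1, h2⟩ := Nat.findGreatest_spec (P := P) (Nat.zero_le _) hP0
  have hcov : ∀ x : E, ‖x‖ ≤ R → ∃ c ∈ s, ‖x - c‖ ≤ ε := by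
    intro x hx
    by_contra! hcon
    have hxs : x ∉ s := fun hxs => by
      have := hcon x hxs
      simp at this
      linarith
    have hk : P (s.card + 1) := by
      refine ⟨insert x s, card_insert_of_notMem hxs, ?_, ?_⟩
      · intro c hc
        rcases mem_insert.1 hc with rfl | hc
        exacts [hx, h1 c hc]
      · intro c hc d hd hcd
        rcases mem_insert.1 hc with rfl | hc <;> rcases mem_insert.1 hd with rfl | hd
        · exact absurd rfl hcd
        · exact (hcon d hd).le
        · rw [norm_sub_rev]; exact (hcon c ‹_›).le
        · exact h2 c hc d hd hcd
    have := Nat.le_findGreatest (hP _ hk) hk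
    rw [hs] at this
    exact absurd this (Nat.not_succ_le_self _)
  refine ⟨s, ?_, card_le_of_separated_ball hR hε s h1 h2, h1, hcov⟩
  obtain ⟨c, hc, -⟩ := hcov 0 (by simpa using hR)
  exact ⟨c, hc⟩

/-- Quadratic Taylor bound for a function with Lipschitz derivative. -/
theorem abs_sub_sub_mul_le_of_lipschitz_deriv {f f' : ℝ → ℝ} {L : ℝ}
    (hf : ∀ x, HasDerivAt f (f' x) x) (hL : ∀ x y, |f' x - f' y| ≤ L * |x - y|) (x h : ℝ) :
    |f (x + h) - f x - f' x * h| ≤ L / 2 * h ^ 2 := by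
  have hp : ∀ (g g' : ℝ → ℝ), (∀ x, HasDerivAt g (g' x) x) →
      (∀ x y, |g' x - g' y| ≤ L * |x - y|) → ∀ x h, 0 ≤ h →
      g (x + h) - g x - g' x * h ≤ L / 2 * h ^ 2 := by
    intro g g' hg hgL x h hh
    have hm : MonotoneOn (fun s => L / 2 * s ^ 2 - (g (x + s) - g x - g' x * s))
        (Set.Ici 0) := by
      have hd : ∀ s, HasDerivAt (fun s => L / 2 * s ^ 2 - (g (x + s) - g x - g' x * s))
          (L * s - (g' (x + s) - g' x)) s := by
        intro s
        have h1 : HasDerivAt (fun s => g (x + s)) (g' (x + s)) s := by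
          simpa using (hg (x + s)).comp_const_add x s
        have h2 : HasDerivAt (fun s => L / 2 * s ^ 2) (L * s) s := by
          have h4 : HasDerivAt (fun s => L / 2 * s ^ 2) (L / 2 * (2 * s)) s := by
            simpa using (hasDerivAt_pow 2 s).const_mul (L / 2)
          have e : L / 2 * (2 * s) = L * s := by ring
          rwa [e] at h4
        have h3 : HasDerivAt (fun s => g' x * s) (g' x) s := by
          simpa using (hasDerivAt_id s).const_mul (g' x)
        exact h2.sub ((h1.sub_const _).sub h3)
      refine monotoneOn_of_deriv_nonneg (convex_Ici 0)
        (fun s _ => (hd s).continuousAt.continuousWithinAt)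
        (fun s _ => (hd s).differentiableAt.differentiableWithinAt) ?_
      intro s hs
      rw [interior_Ici] at hs
      rw [(hd s).deriv]
      have := (le_abs_self _).trans (hgL (x + s) x)
      rw [add_sub_cancel_left, abs_of_pos hs] at this
      linarith
    have := hm (Set.self_mem_Ici) (Set.mem_Ici.2 hh) hh
    simp at this
    linarith
  have hneg : ∀ (g g' : ℝ → ℝ), (∀ x, HasDerivAt g (g' x) x) →
      (∀ x y, |g' x - g' y| ≤ L * |x - y|) → ∀ x h,
      g (x + h) - g x - g' x * h ≤ L / 2 * h ^ 2 := by
    intro g g' hg hgL x h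
    rcases le_total 0 h with hh | hh
    · exact hp g g' hg hgL x h hh
    · have := hp (fun s => g (-s)) (fun s => -g' (-s))
        (fun s => by
          have := (hg (-s)).scomp s (hasDerivAt_neg s)
          simpa [Function.comp_def] using this)
        (fun a b => by
          have := hgL (-a) (-b)
          rw [← abs_neg, ← abs_neg (a - b)]
          convert this using 2 <;> ring_nf) (-x) (-h) (by linarith)
      simp only [neg_neg, neg_add_rev] at this
      rw [add_comm h x] at this
      nlinarith
  rw [abs_le]
  constructor
  · have := hneg (fun s => -f s) (fun s => -f' s) (fun s => (hf s).neg)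
      (fun a b => by
        have := hL a b
        rw [← abs_neg]
        convert this using 2
        ring) x h
    linarith
  · exact hneg f f' hf hL x h

section Product

variable {Z : Type*} [MeasurableSpace Z]

theorem measurable_fin_cons_prod (n : ℕ) :
    Measurable fun q : Z × (Fin n → Z) => (Fin.cons q.1 q.2 : Fin (n + 1) → Z) := by
  refine measurable_pi_lambda _ fun i => ?_
  refine Fin.cases ?_ (fun j => ?_) i
  · simpa using measurable_fst
  · simpa [Function.comp_def] using (measurable_pi_apply j).comp (measurable_snd (α := Z))

theorem integrable_of_measurable_of_abs_le {Ω : Type*} [MeasurableSpace Ω] {μ : Measure Ω}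
    [IsFiniteMeasure μ] {F : Ω → ℝ} {M : ℝ} (hF : Measurable F) (hb : ∀ S, |F S| ≤ M) :
    Integrable F μ :=
  Integrable.of_bound hF.aestronglyMeasurable M (.of_forall hb)

theorem abs_integral_le_of_abs_le {Ω : Type*} [MeasurableSpace Ω] {μ : Measure Ω}
    [IsProbabilityMeasure μ] {F : Ω → ℝ} {M : ℝ} (hb : ∀ S, |F S| ≤ M) :
    |∫ S, F S ∂μ| ≤ M := by
  simpa using norm_integral_le_of_norm_le_const (μ := μ) (f := F) (.of_forall hb)

/-- Fubini for a bounded function of `n + 1` independent coordinates. -/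
theorem integral_pi_fin_succ (ν : Measure Z) [IsProbabilityMeasure ν] {n : ℕ}
    {F : (Fin (n + 1) → Z) → ℝ} {M : ℝ} (hF : Measurable F) (hb : ∀ S, |F S| ≤ M) :
    ∫ S, F S ∂(Measure.pi fun _ : Fin (n + 1) => ν) =
      ∫ z, ∫ S, F (Fin.cons z S) ∂(Measure.pi fun _ : Fin n => ν) ∂ν := by
  have h := (measurePreserving_piFinSuccAbove (fun _ : Fin (n + 1) => ν) 0).symm
  have h1 := h.integral_comp (MeasurableEquiv.measurableEmbedding _) F
  rw [← h1]
  have hfun : ∀ q : Z × (Fin n → Z),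
      (MeasurableEquiv.piFinSuccAbove (fun _ => Z) 0).symm q = Fin.cons q.1 q.2 := by
    intro q
    simp [MeasurableEquiv.piFinSuccAbove, Fin.insertNthEquiv]
  simp only [hfun]
  exact integral_prod (fun q : Z × (Fin n → Z) => F (Fin.cons q.1 q.2))
    (integrable_of_measurable_of_abs_le (hF.comp (measurable_fin_cons_prod n)) fun _ => hb _)

theorem measurable_integral_fin_cons (ν : Measure Z) [IsProbabilityMeasure ν] {n : ℕ}
    {F : (Fin (n + 1) → Z) → ℝ} (hF : Measurable F) :
    Measurable fun z => ∫ S, F (Fin.cons z S) ∂(Measure.pi fun _ : Fin n => ν) :=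
  (StronglyMeasurable.integral_prod_right
    (f := fun z S => F (Fin.cons z S))
    (hF.comp (measurable_fin_cons_prod n)).stronglyMeasurable).measurable

/-- Hoeffding's lemma for a function with oscillation at most `c`. -/
theorem integral_exp_le_of_oscillation (ν : Measure Z) [IsProbabilityMeasure ν]
    {G : Z → ℝ} {c M : ℝ} (hG : Measurable G) (hb : ∀ z, |G z| ≤ M)
    (hc : ∀ z z', |G z - G z'| ≤ c) (l : ℝ) :
    ∫ z, exp (l * (G z - ∫ w, G w ∂ν)) ∂ν ≤ exp (l ^ 2 * c ^ 2 / 8) := by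
  have : Nonempty Z := nonempty_of_isProbabilityMeasure ν
  have hbdd : BddBelow (Set.range G) := ⟨-M, by rintro _ ⟨z, rfl⟩; exact (abs_le.1 (hb z)).1⟩
  have hmem : ∀ z, G z ∈ Set.Icc (⨅ z, G z) ((⨅ z, G z) + c) := by
    refine fun z => ⟨ciInf_le hbdd z, ?_⟩
    have : G z - c ≤ ⨅ z, G z := le_ciInf fun z' => by
      linarith [(abs_le.1 (hc z z')).2]
    linarith
  have h := (ProbabilityTheory.hasSubgaussianMGF_of_mem_Icc (μ := ν) hG.aemeasurable
    (.of_forall hmem)).mgf_le l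
  rw [ProbabilityTheory.mgf] at h
  refine h.trans (le_of_eq ?_)
  congr 1
  simp only [add_sub_cancel_left]
  push_cast
  rw [Real.norm_eq_abs, div_pow, sq_abs]
  ring

/-- Moment generating function bound underlying McDiarmid's inequality. -/
theorem integral_exp_le_of_bounded_differences (ν : Measure Z) [IsProbabilityMeasure ν]
    {c : ℝ} (l : ℝ) : ∀ (n : ℕ) (F : (Fin n → Z) → ℝ) (M : ℝ), Measurable F →
      (∀ S, |F S| ≤ M) →
      (∀ i S S', (∀ j, j ≠ i → S j = S' j) → |F S - F S'| ≤ c) →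
      ∫ S, exp (l * (F S - ∫ S', F S' ∂(Measure.pi fun _ : Fin n => ν)))
        ∂(Measure.pi fun _ : Fin n => ν) ≤ exp (n * (l ^ 2 * c ^ 2 / 8)) := by
  intro n
  induction n with
  | zero =>
    intro F M hF hb hc
    have : ∀ S : Fin 0 → Z, F S = F default := fun S => by rw [Subsingleton.elim S default]
    simp [this]
  | succ n ih =>
    intro F M hF hb hc
    set G : Z → ℝ := fun z => ∫ S, F (Fin.cons z S) ∂(Measure.pi fun _ : Fin n => ν) with hG
    have hGm : Measurable G := measurable_integral_fin_cons ν hF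
    have hGb : ∀ z, |G z| ≤ M := fun z => abs_integral_le_of_abs_le fun S => hb _
    have hFz : ∀ z, Measurable fun S : Fin n → Z => F (Fin.cons z S) := fun z =>
      hF.comp ((measurable_fin_cons_prod n).comp measurable_prodMk_left)
    have hGc : ∀ z z', |G z - G z'| ≤ c := by
      intro z z'
      rw [hG]
      simp only
      rw [← integral_sub (integrable_of_measurable_of_abs_le (hFz z) fun _ => hb _)
        (integrable_of_measurable_of_abs_le (hFz z') fun _ => hb _)]
      refine abs_integral_le_of_abs_le fun S => hc 0 _ _ ?_
      intro j hj
      obtain ⟨i, rfl⟩ := Fin.exists_succ_eq.2 hj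
      simp
    have hEF : ∫ S, F S ∂(Measure.pi fun _ : Fin (n + 1) => ν) = ∫ z, G z ∂ν :=
      integral_pi_fin_succ ν hF hb
    set m := ∫ z, G z ∂ν
    have hm : |m| ≤ M := abs_integral_le_of_abs_le hGb
    rw [hEF, integral_pi_fin_succ ν (F := fun S => exp (l * (F S - m))) (M := exp (|l| * (M + M)))
      (Real.measurable_exp.comp ((hF.sub_const m).const_mul l)) ?_]
    · have hstep : ∀ z, ∫ S, exp (l * (F (Fin.cons z S) - m)) ∂(Measure.pi fun _ : Fin n => ν)
          ≤ exp (n * (l ^ 2 * c ^ 2 / 8)) * exp (l * (G z - m)) := by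
        intro z
        have := ih (fun S => F (Fin.cons z S)) M (hFz z) (fun _ => hb _) (by
          intro i S S' hS
          refine hc i.succ _ _ ?_
          intro j hj
          refine Fin.cases (fun _ => by simp) (fun k hk => ?_) j hj
          simpa using hS k (fun h => hk (by rw [h])))
        calc _ = ∫ S, exp (l * (F (Fin.cons z S) - G z)) * exp (l * (G z - m))
              ∂(Measure.pi fun _ : Fin n => ν) := by
                congr 1; ext S; rw [← exp_add]; ring_nf
          _ = (∫ S, exp (l * (F (Fin.cons z S) - G z)) ∂(Measure.pi fun _ : Fin n => ν))
              * exp (l * (G z - m)) := integral_mul_const _ _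
          _ ≤ _ := by gcongr
      have hexpG : Integrable (fun z => exp (l * (G z - m))) ν := by
        refine integrable_of_measurable_of_abs_le (M := exp (|l| * (M + M)))
          (Real.measurable_exp.comp ((hGm.sub_const m).const_mul l)) fun z => ?_
        rw [abs_exp, exp_le_exp]
        refine (le_abs_self _).trans ?_
        rw [abs_mul]
        gcongr
        exact (abs_sub _ _).trans (add_le_add (hGb z) hm)
      calc _ ≤ ∫ z, exp (n * (l ^ 2 * c ^ 2 / 8)) * exp (l * (G z - m)) ∂ν := by
            refine integral_mono_of_nonneg (.of_forall fun z => ?_) (hexpG.const_mul _)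
              (.of_forall hstep)
            exact integral_nonneg fun S => (exp_pos _).le
        _ = exp (n * (l ^ 2 * c ^ 2 / 8)) * ∫ z, exp (l * (G z - m)) ∂ν :=
            integral_const_mul _ _
        _ ≤ exp (n * (l ^ 2 * c ^ 2 / 8)) * exp (l ^ 2 * c ^ 2 / 8) := by
            gcongr
            exact integral_exp_le_of_oscillation ν hGm hGb hGc l
        _ = _ := by rw [← exp_add]; push_cast; ring_nf
    · intro S
      rw [abs_exp, exp_le_exp]
      refine (le_abs_self _).trans ?_
      rw [abs_mul]
      gcongr
      exact (abs_sub _ _).trans (add_le_add (hb S) hm)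

/-- **McDiarmid's inequality**. -/
theorem measure_add_le_of_bounded_differences (ν : Measure Z) [IsProbabilityMeasure ν] {n : ℕ}
    (hn : 0 < n) {F : (Fin n → Z) → ℝ} {M c s : ℝ} (hF : Measurable F) (hb : ∀ S, |F S| ≤ M)
    (hc0 : 0 < c) (hc : ∀ i S S', (∀ j, j ≠ i → S j = S' j) → |F S - F S'| ≤ c) (hs : 0 ≤ s) :
    (Measure.pi fun _ : Fin n => ν)
        {S | (∫ S', F S' ∂(Measure.pi fun _ : Fin n => ν)) + s ≤ F S} ≤
      ENNReal.ofReal (exp (-(2 * s ^ 2) / (n * c ^ 2))) := by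
  set μ := Measure.pi fun _ : Fin n => ν
  have hnR : (0 : ℝ) < n := Nat.cast_pos.2 hn
  set l : ℝ := 4 * s / (n * c ^ 2) with hl
  have hl0 : 0 ≤ l := by positivity
  set m := ∫ S', F S' ∂μ
  have hint : Integrable (fun S => exp (l * (F S - m))) μ := by
    refine integrable_of_measurable_of_abs_le (M := exp (|l| * (M + M)))
      (Real.measurable_exp.comp ((hF.sub_const m).const_mul l)) fun z => ?_
    rw [abs_exp, exp_le_exp]
    refine (le_abs_self _).trans ?_
    rw [abs_mul]
    gcongr
    exact (abs_sub _ _).trans (add_le_add (hb z) (abs_integral_le_of_abs_le hb))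
  have h1 := ProbabilityTheory.measure_ge_le_exp_mul_mgf (μ := μ) (X := fun S => F S - m) s hl0 hint
  have h2 := integral_exp_le_of_bounded_differences ν l n F M hF hb hc
  have h3 : {S | m + s ≤ F S} = {S | s ≤ F S - m} := by
    ext S; simp only [Set.mem_ofPred_eq]; constructor <;> intro h <;> linarith
  rw [h3, ← ofReal_measureReal]
  refine ENNReal.ofReal_le_ofReal (h1.trans ?_)
  calc _ ≤ exp (-l * s) * exp (n * (l ^ 2 * c ^ 2 / 8)) := by
        gcongr
        exact h2
    _ = _ := by
        rw [← exp_add]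
        congr 1
        rw [hl]
        field_simp
        ring

end Product

/-- The sign `±1` encoded by a Boolean. -/
def boolSign (e : Bool) : ℝ := if e then 1 else -1

theorem abs_boolSign (e : Bool) : |boolSign e| = 1 := by
  cases e <;> simp [boolSign]

theorem bddAbove_range_of_abs_le {ι : Type*} {f : ι → ℝ} {M : ℝ} (h : ∀ t, |f t| ≤ M) :
    BddAbove (Set.range f) :=
  ⟨M, by rintro _ ⟨t, rfl⟩; exact (abs_le.1 (h t)).2⟩

theorem abs_ciSup_le {ι : Type*} [Nonempty ι] {f : ι → ℝ} {M : ℝ} (h : ∀ t, |f t| ≤ M) :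
    |⨆ t, f t| ≤ M := by
  obtain ⟨t⟩ := ‹Nonempty ι›
  have : Nonempty ι := ⟨t⟩
  exact abs_le.2 ⟨(abs_le.1 (h t)).1.trans (le_ciSup (bddAbove_range_of_abs_le h) t),
    ciSup_le fun s => (abs_le.1 (h s)).2⟩

theorem abs_ciSup_sub_ciSup_le {ι : Type*} [Nonempty ι] {f g : ι → ℝ} {M c : ℝ}
    (hf : ∀ t, |f t| ≤ M) (hg : ∀ t, |g t| ≤ M) (h : ∀ t, |f t - g t| ≤ c) :
    |(⨆ t, f t) - ⨆ t, g t| ≤ c := by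
  rw [abs_le]
  constructor
  · have : (⨆ t, g t) ≤ (⨆ t, f t) + c := ciSup_le fun t => by
      linarith [le_ciSup (bddAbove_range_of_abs_le hf) t, (abs_le.1 (h t)).1]
    linarith
  · have : (⨆ t, f t) ≤ (⨆ t, g t) + c := ciSup_le fun t => by
      linarith [le_ciSup (bddAbove_range_of_abs_le hg) t, (abs_le.1 (h t)).2]
    linarith

/-- One-coordinate contraction step. -/
theorem ciSup_add_add_ciSup_sub_le {ι : Type*} [Nonempty ι] {B p q : ι → ℝ} {M : ℝ}
    (hBa : ∀ t, |B t + q t| ≤ M) (hBs : ∀ t, |B t - q t| ≤ M)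
    (h : ∀ s t, |p s - p t| ≤ |q s - q t|) :
    (⨆ t, (B t + p t)) + (⨆ t, (B t - p t)) ≤ (⨆ t, (B t + q t)) + ⨆ t, (B t - q t) := by
  have key : ∀ s t, (B s + p s) + (B t - p t) ≤ (⨆ t, (B t + q t)) + ⨆ t, (B t - q t) := by
    intro s t
    have h1 := le_ciSup (bddAbove_range_of_abs_le hBa)
    have h2 := le_ciSup (bddAbove_range_of_abs_le hBs)
    have h3 := (le_abs_self _).trans (h s t)
    rcases abs_cases (q s - q t) with ⟨h4, -⟩ | ⟨h4, -⟩
    · linarith [h1 s, h2 t]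
    · linarith [h1 t, h2 s]
  have : (⨆ s, (B s + p s)) ≤ (⨆ t, (B t + q t)) + (⨆ t, (B t - q t)) - ⨆ t, (B t - p t) := by
    refine ciSup_le fun s => ?_
    have : (⨆ t, (B t - p t)) ≤
        (⨆ t, (B t + q t)) + (⨆ t, (B t - q t)) - (B s + p s) :=
      ciSup_le fun t => by linarith [key s t]
    linarith
  linarith

theorem sum_fin_cons_bool {n : ℕ} (g : (Fin (n + 1) → Bool) → ℝ) :
    ∑ ε : Fin (n + 1) → Bool, g ε =
      ∑ ε : Fin n → Bool, (g (Fin.cons true ε) + g (Fin.cons false ε)) := by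
  rw [← Equiv.sum_comp (Fin.consEquiv fun _ => Bool), Fintype.sum_prod_type]
  simp [Fin.consEquiv, Finset.sum_add_distrib]

section Symmetrization

variable {Z ι : Type*} [MeasurableSpace Z] [Countable ι] [Nonempty ι]

/-- Symmetrization and contraction for a single coordinate. -/
theorem integral_ciSup_le_symm (ν : Measure Z) [IsProbabilityMeasure ν]
    {φ ψ : ι → Z → ℝ} {M a : ℝ} (hφm : ∀ t, Measurable (φ t)) (hψm : ∀ t, Measurable (ψ t))
    (hφ : ∀ t z, |φ t z| ≤ M) (hψ : ∀ t z, |ψ t z| ≤ M)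
    (hc : ∀ s t z, |φ s z - φ t z| ≤ |ψ s z - ψ t z|) (A : ι → ℝ) (hA : ∀ t, |A t| ≤ a) :
    ∫ z, ⨆ t, (A t + (∫ w, φ t w ∂ν - φ t z)) ∂ν ≤
      ∫ z, (1 / 2 : ℝ) * ((⨆ t, (A t + 2 * ψ t z)) + ⨆ t, (A t - 2 * ψ t z)) ∂ν := by
  have hM : 0 ≤ M := (abs_nonneg _).trans
    (hφ (Classical.arbitrary ι) (nonempty_of_isProbabilityMeasure ν).some)
  have hE : ∀ t, |∫ w, φ t w ∂ν| ≤ M := fun t => abs_integral_le_of_abs_le (hφ t)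
  have bnd : ∀ x y : ℝ, |x| ≤ a → |y| ≤ M → |x + 2 * y| ≤ a + 2 * M ∧ |x - 2 * y| ≤ a + 2 * M := by
    intro x y hx hy
    have h1 := abs_le.1 hx
    have h2 := abs_le.1 hy
    constructor <;> rw [abs_le] <;> constructor <;> linarith
  have ip : ∀ (f : ι → Z → ℝ), (∀ t, Measurable (f t)) → (∀ t z, |f t z| ≤ M) →
      Integrable (fun z => ⨆ t, (A t + 2 * f t z)) ν := fun f hfm hf =>
    integrable_of_measurable_of_abs_le
      (Measurable.iSup fun t => ((hfm t).const_mul 2).const_add (A t))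
      fun z => abs_ciSup_le fun t => (bnd _ _ (hA t) (hf t z)).1
  have im : ∀ (f : ι → Z → ℝ), (∀ t, Measurable (f t)) → (∀ t z, |f t z| ≤ M) →
      Integrable (fun z => ⨆ t, (A t - 2 * f t z)) ν := fun f hfm hf =>
    integrable_of_measurable_of_abs_le
      (Measurable.iSup fun t => ((hfm t).const_mul 2).const_sub (A t))
      fun z => abs_ciSup_le fun t => (bnd _ _ (hA t) (hf t z)).2
  have i0 : Integrable (fun z => ⨆ t, (A t + (∫ w, φ t w ∂ν - φ t z))) ν :=
    integrable_of_measurable_of_abs_le (M := a + 2 * M)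
      (Measurable.iSup fun t => ((hφm t).const_sub _).const_add (A t))
      fun z => abs_ciSup_le fun t => by
        have h1 := abs_le.1 (hA t)
        have h2 := abs_le.1 (hφ t z)
        have h3 := abs_le.1 (hE t)
        rw [abs_le]; constructor <;> linarith
  have hJ : (⨆ t, (A t + 2 * ∫ w, φ t w ∂ν)) ≤ ∫ z, ⨆ t, (A t + 2 * φ t z) ∂ν := by
    refine ciSup_le fun t => ?_
    have hi : Integrable (φ t) ν := integrable_of_measurable_of_abs_le (hφm t) (hφ t)
    have : A t + 2 * ∫ w, φ t w ∂ν = ∫ z, (A t + 2 * φ t z) ∂ν := by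
      rw [integral_add (integrable_const _) (hi.const_mul 2), integral_const_mul]
      simp
    rw [this]
    exact integral_mono ((integrable_const _).add (hi.const_mul 2)) (ip φ hφm hφ) fun z =>
      le_ciSup (f := fun t => A t + 2 * φ t z)
        (bddAbove_range_of_abs_le fun t => (bnd _ _ (hA t) (hφ t z)).1) t
  calc _ ≤ ∫ z, (1 / 2 : ℝ) * ((⨆ t, (A t + 2 * ∫ w, φ t w ∂ν))
          + ⨆ t, (A t - 2 * φ t z)) ∂ν := by
        refine integral_mono i0 (((integrable_const _).add (im φ hφm hφ)).const_mul _) fun z => ?_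
        refine ciSup_le fun t => ?_
        have h1 := le_ciSup (f := fun t => A t + 2 * ∫ w, φ t w ∂ν)
          (bddAbove_range_of_abs_le fun t => (bnd _ _ (hA t) (hE t)).1) t
        have h2 := le_ciSup (f := fun t => A t - 2 * φ t z)
          (bddAbove_range_of_abs_le fun t => (bnd _ _ (hA t) (hφ t z)).2) t
        linarith
    _ = (1 / 2 : ℝ) * ((⨆ t, (A t + 2 * ∫ w, φ t w ∂ν))
          + ∫ z, ⨆ t, (A t - 2 * φ t z) ∂ν) := by
        rw [integral_const_mul, integral_add (integrable_const _) (im φ hφm hφ)]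
        simp
    _ ≤ (1 / 2 : ℝ) * ((∫ z, ⨆ t, (A t + 2 * φ t z) ∂ν)
          + ∫ z, ⨆ t, (A t - 2 * φ t z) ∂ν) := by linarith
    _ = ∫ z, (1 / 2 : ℝ) * ((⨆ t, (A t + 2 * φ t z)) + ⨆ t, (A t - 2 * φ t z)) ∂ν := by
        rw [integral_const_mul, integral_add (ip φ hφm hφ) (im φ hφm hφ)]
    _ ≤ _ := by
        refine integral_mono (((ip φ hφm hφ).add (im φ hφm hφ)).const_mul _)
          (((ip ψ hψm hψ).add (im ψ hψm hψ)).const_mul _) fun z => ?_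
        have := ciSup_add_add_ciSup_sub_le (B := A) (p := fun t => 2 * φ t z)
          (q := fun t => 2 * ψ t z) (fun t => (bnd _ _ (hA t) (hψ t z)).1)
          (fun t => (bnd _ _ (hA t) (hψ t z)).2) (fun s t => by
            rw [← mul_sub, ← mul_sub, abs_mul, abs_mul]
            exact mul_le_mul_of_nonneg_left (hc s t z) (abs_nonneg _))
        simp only
        linarith

/-- Symmetrization and contraction for empirical processes over `n` samples. -/
theorem integral_ciSup_sum_le_rademacher (ν : Measure Z) [IsProbabilityMeasure ν]
    {φ ψ : ι → Z → ℝ} {M : ℝ} (hφm : ∀ t, Measurable (φ t)) (hψm : ∀ t, Measurable (ψ t))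
    (hφ : ∀ t z, |φ t z| ≤ M) (hψ : ∀ t z, |ψ t z| ≤ M)
    (hc : ∀ s t z, |φ s z - φ t z| ≤ |ψ s z - ψ t z|) :
    ∀ (n : ℕ) (A : ι → ℝ) (a : ℝ), (∀ t, |A t| ≤ a) →
    ∫ S : Fin n → Z, ⨆ t, (A t + ∑ i, (∫ w, φ t w ∂ν - φ t (S i)))
        ∂(Measure.pi fun _ : Fin n => ν) ≤
      ∫ S : Fin n → Z, (1 / 2 ^ n : ℝ) * ∑ ε : Fin n → Bool,
        ⨆ t, (A t + ∑ i, boolSign (ε i) * (2 * ψ t (S i))) ∂(Measure.pi fun _ : Fin n => ν) := by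
  have hM : 0 ≤ M := (abs_nonneg _).trans
    (hφ (Classical.arbitrary ι) (nonempty_of_isProbabilityMeasure ν).some)
  have hE : ∀ t, |∫ w, φ t w ∂ν| ≤ M := fun t => abs_integral_le_of_abs_le (hφ t)
  have bφ : ∀ (n : ℕ) (S : Fin n → Z) t, |∑ i, (∫ w, φ t w ∂ν - φ t (S i))| ≤ n * (2 * M) := by
    intro n S t
    refine (abs_sum_le_sum_abs _ _).trans ((sum_le_card_nsmul _ _ (2 * M) fun i _ => ?_).trans ?_)
    · refine (abs_sub _ _).trans ?_
      linarith [hE t, hφ t (S i)]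
    · simp
  have bψ : ∀ (n : ℕ) (S : Fin n → Z) (ε : Fin n → Bool) t,
      |∑ i, boolSign (ε i) * (2 * ψ t (S i))| ≤ n * (2 * M) := by
    intro n S ε t
    refine (abs_sum_le_sum_abs _ _).trans ((sum_le_card_nsmul _ _ (2 * M) fun i _ => ?_).trans ?_)
    · rw [abs_mul, abs_boolSign, abs_mul, one_mul, abs_two]
      linarith [hψ t (S i)]
    · simp
  have mφ : ∀ (n : ℕ) (A : ι → ℝ), Measurable fun S : Fin n → Z =>
      ⨆ t, (A t + ∑ i, (∫ w, φ t w ∂ν - φ t (S i))) := fun n A =>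
    Measurable.iSup fun t => (Finset.measurable_sum _ fun i _ =>
      ((hφm t).comp (measurable_pi_apply i)).const_sub _).const_add _
  have mψ : ∀ (n : ℕ) (A : ι → ℝ) (ε : Fin n → Bool), Measurable fun S : Fin n → Z =>
      ⨆ t, (A t + ∑ i, boolSign (ε i) * (2 * ψ t (S i))) := fun n A ε =>
    Measurable.iSup fun t => (Finset.measurable_sum _ fun i _ =>
      (((hψm t).comp (measurable_pi_apply i)).const_mul _).const_mul _).const_add _
  have sb : ∀ {x y a b : ℝ}, |x| ≤ a → |y| ≤ b → |x + y| ≤ a + b := fun hx hy =>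
    (abs_add_le _ _).trans (add_le_add hx hy)
  intro n
  induction n with
  | zero =>
    intro A a hA
    simp
  | succ n ih =>
    intro A a hA
    set μ := Measure.pi fun _ : Fin n => ν with hμ
    rw [integral_pi_fin_succ ν (mφ (n + 1) A) fun S =>
      abs_ciSup_le fun t => sb (hA t) (bφ _ S t)]
    have hcb : ∀ z t, |A t + (∫ w, φ t w ∂ν - φ t z)| ≤ a + 2 * M := by
      intro z t
      refine sb (hA t) ((abs_sub _ _).trans ?_)
      linarith [hE t, hφ t z]
    set R : Z → (Fin n → Z) → ℝ := fun z S => (1 / 2 ^ n : ℝ) * ∑ ε : Fin n → Bool,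
      ⨆ t, (A t + (∫ w, φ t w ∂ν - φ t z) + ∑ i, boolSign (ε i) * (2 * ψ t (S i))) with hR
    have hRm : Measurable (Function.uncurry R) := by
      refine (Finset.measurable_sum _ fun ε _ => Measurable.iSup fun t => ?_).const_mul _
      refine (((hφm t).comp measurable_fst).const_sub _ |>.const_add _).add ?_
      exact Finset.measurable_sum _ fun i _ =>
        (((hψm t).comp ((measurable_pi_apply i).comp measurable_snd)).const_mul _).const_mul _
    have avg : ∀ (k : ℕ) (f : (Fin k → Bool) → ℝ) (b : ℝ), (∀ ε, |f ε| ≤ b) →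
        |(1 / 2 ^ k : ℝ) * ∑ ε, f ε| ≤ b := by
      intro k f b hf
      rw [abs_mul, abs_of_pos (by positivity : (0 : ℝ) < 1 / 2 ^ k), one_div,
        inv_mul_le_iff₀ (by positivity)]
      refine (abs_sum_le_sum_abs _ _).trans ((sum_le_card_nsmul _ _ b fun i _ => hf i).trans ?_)
      simp
    have hRb : ∀ z S, |R z S| ≤ a + 2 * M + n * (2 * M) := fun z S =>
      avg _ _ _ fun ε => abs_ciSup_le fun t => sb (hcb z t) (bψ _ S ε t)
    have hRi : Integrable (Function.uncurry R) (ν.prod μ) :=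
      integrable_of_measurable_of_abs_le hRm fun q => hRb _ _
    have hcons : ∀ z (S : Fin n → Z) t,
        A t + ∑ i, (∫ w, φ t w ∂ν - φ t ((Fin.cons z S : Fin (n + 1) → Z) i)) =
        A t + (∫ w, φ t w ∂ν - φ t z) + ∑ i, (∫ w, φ t w ∂ν - φ t (S i)) := by
      intro z S t
      rw [Fin.sum_univ_succ]
      simp only [Fin.cons_zero, Fin.cons_succ]
      ring
    have h1 : ∀ z, ∫ S, ⨆ t, (A t + ∑ i, (∫ w, φ t w ∂ν
        - φ t ((Fin.cons z S : Fin (n + 1) → Z) i))) ∂μ ≤ ∫ S, R z S ∂μ := by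
      intro z
      simp only [hcons]
      exact ih (fun t => A t + (∫ w, φ t w ∂ν - φ t z)) (a + 2 * M) (hcb z)
    have h2 : ∀ S, ∫ z, R z S ∂ν ≤ ∫ z, (1 / 2 ^ (n + 1) : ℝ) * ∑ ε : Fin (n + 1) → Bool,
        ⨆ t, (A t + ∑ i, boolSign (ε i) * (2 * ψ t ((Fin.cons z S : Fin (n + 1) → Z) i))) ∂ν := by
      intro S
      have hAb : ∀ ε : Fin n → Bool, ∀ t,
          |A t + ∑ i, boolSign (ε i) * (2 * ψ t (S i))| ≤ a + n * (2 * M) := fun ε t =>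
        sb (hA t) (bψ _ S ε t)
      have e1 : ∀ z, R z S = (1 / 2 ^ n : ℝ) * ∑ ε : Fin n → Bool,
          ⨆ t, ((A t + ∑ i, boolSign (ε i) * (2 * ψ t (S i))) + (∫ w, φ t w ∂ν - φ t z)) := by
        intro z
        rw [hR]
        simp only
        congr 1
        refine sum_congr rfl fun ε _ => ?_
        congr 1
        ext t
        ring
      have e2 : ∀ z, (1 / 2 ^ (n + 1) : ℝ) * ∑ ε : Fin (n + 1) → Bool,
          ⨆ t, (A t + ∑ i, boolSign (ε i) * (2 * ψ t ((Fin.cons z S : Fin (n + 1) → Z) i))) =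
          (1 / 2 ^ n : ℝ) * ∑ ε : Fin n → Bool, (1 / 2 : ℝ) *
            ((⨆ t, ((A t + ∑ i, boolSign (ε i) * (2 * ψ t (S i))) + 2 * ψ t z)) +
            ⨆ t, ((A t + ∑ i, boolSign (ε i) * (2 * ψ t (S i))) - 2 * ψ t z)) := by
        intro z
        rw [sum_fin_cons_bool, ← mul_sum, ← mul_assoc]
        have : (1 / 2 ^ (n + 1) : ℝ) = 1 / 2 ^ n * (1 / 2) := by rw [pow_succ]; field_simp
        rw [this]
        congr 1
        refine sum_congr rfl fun ε _ => ?_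
        congr 1 <;>
        · congr 1
          ext t
          rw [Fin.sum_univ_succ]
          simp only [Fin.cons_zero, Fin.cons_succ, boolSign]
          simp
          ring
      have ip : ∀ ε : Fin n → Bool, Integrable (fun z =>
          ⨆ t, ((A t + ∑ i, boolSign (ε i) * (2 * ψ t (S i))) + 2 * ψ t z)) ν := fun ε =>
        integrable_of_measurable_of_abs_le (M := a + n * (2 * M) + 2 * M)
          (Measurable.iSup fun t => ((hψm t).const_mul 2).const_add _)
          fun z => abs_ciSup_le fun t => sb (hAb ε t) (by
            rw [abs_mul, abs_two]; linarith [hψ t z])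
      have im : ∀ ε : Fin n → Bool, Integrable (fun z =>
          ⨆ t, ((A t + ∑ i, boolSign (ε i) * (2 * ψ t (S i))) - 2 * ψ t z)) ν := fun ε =>
        integrable_of_measurable_of_abs_le (M := a + n * (2 * M) + 2 * M)
          (Measurable.iSup fun t => ((hψm t).const_mul 2).const_sub _)
          fun z => abs_ciSup_le fun t => (abs_sub _ _).trans (add_le_add (hAb ε t) (by
            rw [abs_mul, abs_two]; linarith [hψ t z]))
      have i0 : ∀ ε : Fin n → Bool, Integrable (fun z => ⨆ t,
          ((A t + ∑ i, boolSign (ε i) * (2 * ψ t (S i))) + (∫ w, φ t w ∂ν - φ t z))) ν := fun ε =>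
        integrable_of_measurable_of_abs_le (M := a + n * (2 * M) + 2 * M)
          (Measurable.iSup fun t => ((hφm t).const_sub _).const_add _)
          fun z => abs_ciSup_le fun t => sb (hAb ε t) ((abs_sub _ _).trans (by
            linarith [hE t, hφ t z]))
      simp only [e1, e2]
      have ic : ∀ ε : Fin n → Bool, Integrable (fun z => (1 / 2 : ℝ) *
          ((⨆ t, ((A t + ∑ i, boolSign (ε i) * (2 * ψ t (S i))) + 2 * ψ t z)) +
            ⨆ t, ((A t + ∑ i, boolSign (ε i) * (2 * ψ t (S i))) - 2 * ψ t z))) ν := fun ε =>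
        ((ip ε).add (im ε)).const_mul _
      rw [integral_const_mul, integral_const_mul, integral_finsetSum _ fun ε _ => i0 ε,
        integral_finsetSum _ fun ε _ => ic ε]
      exact mul_le_mul_of_nonneg_left (sum_le_sum fun ε _ =>
        integral_ciSup_le_symm ν hφm hψm hφ hψ hc _ (hAb ε)) (by positivity)
    have hψi : Measurable fun S : Fin (n + 1) → Z => (1 / 2 ^ (n + 1) : ℝ) *
        ∑ ε : Fin (n + 1) → Bool, ⨆ t, (A t + ∑ i, boolSign (ε i) * (2 * ψ t (S i))) :=
      (Finset.measurable_sum _ fun ε _ => mψ (n + 1) A ε).const_mul _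
    have hψb : ∀ S : Fin (n + 1) → Z, |(1 / 2 ^ (n + 1) : ℝ) *
        ∑ ε : Fin (n + 1) → Bool, ⨆ t, (A t + ∑ i, boolSign (ε i) * (2 * ψ t (S i)))| ≤
        a + (n + 1 : ℕ) * (2 * M) := fun S =>
      avg _ _ _ fun ε => abs_ciSup_le fun t => sb (hA t) (bψ _ S ε t)
    have hprod : Integrable (Function.uncurry fun (z : Z) (S : Fin n → Z) =>
        (1 / 2 ^ (n + 1) : ℝ) * ∑ ε : Fin (n + 1) → Bool, ⨆ t, (A t + ∑ i, boolSign (ε i) *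
          (2 * ψ t ((Fin.cons z S : Fin (n + 1) → Z) i)))) (ν.prod μ) :=
      integrable_of_measurable_of_abs_le (hψi.comp (measurable_fin_cons_prod n)) fun q => hψb _
    calc _ ≤ ∫ z, ∫ S, R z S ∂μ ∂ν := by
          refine integral_mono (integrable_of_measurable_of_abs_le
            (measurable_integral_fin_cons ν (mφ (n + 1) A)) fun z =>
              abs_integral_le_of_abs_le fun S => abs_ciSup_le fun t => sb (hA t) (bφ _ _ t))
            hRi.integral_prod_left h1
      _ = ∫ S, ∫ z, R z S ∂ν ∂μ := integral_integral_swap hRi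
      _ ≤ ∫ S, ∫ z, (1 / 2 ^ (n + 1) : ℝ) * ∑ ε : Fin (n + 1) → Bool,
            ⨆ t, (A t + ∑ i, boolSign (ε i) *
              (2 * ψ t ((Fin.cons z S : Fin (n + 1) → Z) i))) ∂ν ∂μ :=
          integral_mono hRi.integral_prod_right hprod.integral_prod_right h2
      _ = ∫ z, ∫ S, (1 / 2 ^ (n + 1) : ℝ) * ∑ ε : Fin (n + 1) → Bool,
            ⨆ t, (A t + ∑ i, boolSign (ε i) *
              (2 * ψ t ((Fin.cons z S : Fin (n + 1) → Z) i))) ∂μ ∂ν :=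
          (integral_integral_swap hprod).symm
      _ = _ := (integral_pi_fin_succ ν hψi hψb).symm

end Symmetrization

/-- **Massart's finite class lemma**. -/
theorem rademacher_finite_class_le {ι : Type*} (s : Finset ι) (hs : s.Nonempty) {n : ℕ}
    (hn : 0 < n) (c : ι → Fin n → ℝ) {K L : ℝ} (hK : 0 < K) (hL : 0 < L)
    (hc : ∀ t ∈ s, ∀ i, |c t i| ≤ K) (hcard : Real.log s.card ≤ L) :
    (1 / 2 ^ n : ℝ) * ∑ ε : Fin n → Bool, s.sup' hs (fun t => ∑ i, boolSign (ε i) * c t i) ≤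
      K * Real.sqrt (2 * n * L) := by
  have hnR : (0 : ℝ) < n := Nat.cast_pos.2 hn
  set l : ℝ := Real.sqrt (2 * L / n) / K with hl
  have hl0 : 0 < l := by positivity
  set q : ℝ := Real.log s.card + n * (l ^ 2 * K ^ 2 / 2) with hq
  have hcs : (0 : ℝ) < s.card := Nat.cast_pos.2 hs.card_pos
  have hmgf : ∀ t ∈ s, ∑ ε : Fin n → Bool, exp (l * ∑ i, boolSign (ε i) * c t i) ≤
      2 ^ n * exp (n * (l ^ 2 * K ^ 2 / 2)) := by
    intro t ht
    have e : ∀ ε : Fin n → Bool, exp (l * ∑ i, boolSign (ε i) * c t i) =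
        ∏ i, exp (l * (boolSign (ε i) * c t i)) := fun ε => by rw [mul_sum, exp_sum]
    simp only [e]
    have e2 := (Finset.prod_univ_sum (fun _ : Fin n => (Finset.univ : Finset Bool))
      (fun i b => exp (l * (boolSign b * c t i)))).symm
    rw [Fintype.piFinset_univ] at e2
    rw [e2]
    calc _ ≤ ∏ _i : Fin n, (2 * exp (l ^ 2 * K ^ 2 / 2)) := by
          refine prod_le_prod (fun i _ => by positivity) fun i _ => ?_
          have h1 := Real.cosh_le_exp_half_sq (l * c t i)
          rw [Real.cosh_eq] at h1
          have h2 : exp ((l * c t i) ^ 2 / 2) ≤ exp (l ^ 2 * K ^ 2 / 2) := by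
            rw [exp_le_exp, mul_pow]
            have : c t i ^ 2 ≤ K ^ 2 := by
              rw [← sq_abs (c t i)]
              exact pow_le_pow_left₀ (abs_nonneg _) (hc t ht i) 2
            gcongr
          simp only [Fintype.sum_bool, boolSign]
          simp only [if_true, Bool.false_eq_true, if_false, one_mul, neg_one_mul, mul_neg]
          linarith
      _ = _ := by
          rw [prod_const, card_univ, Fintype.card_fin, mul_pow, ← exp_nat_mul]
  have hpt : ∀ ε : Fin n → Bool, l * s.sup' hs (fun t => ∑ i, boolSign (ε i) * c t i) ≤
      q - 1 + exp (-q) * ∑ t ∈ s, exp (l * ∑ i, boolSign (ε i) * c t i) := by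
    intro ε
    obtain ⟨t, ht, h⟩ := s.exists_mem_eq_sup' hs (fun t => ∑ i, boolSign (ε i) * c t i)
    rw [h]
    set y := l * ∑ i, boolSign (ε i) * c t i with hy
    have h1 : exp y ≤ ∑ t ∈ s, exp (l * ∑ i, boolSign (ε i) * c t i) :=
      single_le_sum (f := fun t => exp (l * ∑ i, boolSign (ε i) * c t i))
        (fun _ _ => (exp_pos _).le) ht
    have h2 := add_one_le_exp (y - q)
    have h3 : exp (y - q) = exp (-q) * exp y := by rw [← exp_add]; ring_nf
    have h4 := mul_le_mul_of_nonneg_left h1 (exp_pos (-q)).le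
    linarith
  have hsum : l * ((1 / 2 ^ n : ℝ) * ∑ ε : Fin n → Bool,
      s.sup' hs (fun t => ∑ i, boolSign (ε i) * c t i)) ≤ q := by
    have hA : ∑ ε : Fin n → Bool, l * s.sup' hs (fun t => ∑ i, boolSign (ε i) * c t i) ≤
        2 ^ n * q := by
      calc _ ≤ ∑ ε : Fin n → Bool,
            (q - 1 + exp (-q) * ∑ t ∈ s, exp (l * ∑ i, boolSign (ε i) * c t i)) :=
            sum_le_sum fun ε _ => hpt ε
        _ = 2 ^ n * (q - 1) + exp (-q) * ∑ t ∈ s, ∑ ε : Fin n → Bool,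
              exp (l * ∑ i, boolSign (ε i) * c t i) := by
            rw [sum_add_distrib, ← mul_sum, sum_comm]
            simp [mul_sub]
        _ ≤ 2 ^ n * (q - 1) + exp (-q) * ∑ t ∈ s, 2 ^ n * exp (n * (l ^ 2 * K ^ 2 / 2)) := by
            gcongr with t ht
            exact hmgf t ht
        _ = 2 ^ n * q := by
            have : exp (-q) * (s.card * exp (n * (l ^ 2 * K ^ 2 / 2))) = 1 := by
              rw [hq, neg_add, exp_add, exp_neg (Real.log _), exp_log hcs, exp_neg]
              field_simp
            rw [sum_const, nsmul_eq_mul]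
            linear_combination 2 ^ n * this
    rw [mul_left_comm, mul_sum, one_div, inv_mul_le_iff₀ (by positivity)]
    exact hA
  have hl2 : l ^ 2 * K ^ 2 = 2 * L / n := by
    rw [hl, div_pow, Real.sq_sqrt (by positivity)]
    field_simp
  have hq2 : q ≤ 2 * L := by
    rw [hq, hl2]
    have : (n : ℝ) * (2 * L / n / 2) = L := by field_simp
    linarith
  have hfin : l * (K * Real.sqrt (2 * n * L)) = 2 * L := by
    have : l * (K * Real.sqrt (2 * n * L)) = Real.sqrt (2 * L / n) * Real.sqrt (2 * n * L) := by
      rw [hl]; field_simp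
    rw [this, ← Real.sqrt_mul (by positivity)]
    have : 2 * L / n * (2 * n * L) = (2 * L) ^ 2 := by field_simp
    rw [this, Real.sqrt_sq (by positivity)]
  exact le_of_mul_le_mul_left (by linarith) hl0

theorem ramp_eq_max_min {γ : ℝ} (hγ : 0 < γ) (v : ℝ) : ramp γ v = max 0 (min 1 (1 - v / γ)) := by
  unfold ramp
  split_ifs with h1 h2
  · have : v / γ < 0 := div_neg_of_neg_of_pos h1 hγ
    rw [min_eq_left (by linarith), max_eq_right zero_le_one]
  · have h3 : 0 ≤ v / γ := div_nonneg (not_lt.1 h1) hγ.le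
    have h4 : v / γ ≤ 1 := (div_le_one hγ).2 h2
    rw [min_eq_right (by linarith), max_eq_right (by linarith)]
  · have h4 : 1 < v / γ := (one_lt_div hγ).2 (not_le.1 h2)
    rw [min_eq_right (by linarith), max_eq_left (by linarith)]

theorem ramp_nonneg {γ : ℝ} (hγ : 0 < γ) (v : ℝ) : 0 ≤ ramp γ v := by
  rw [ramp_eq_max_min hγ]; exact le_max_left _ _

theorem ramp_le_one {γ : ℝ} (hγ : 0 < γ) (v : ℝ) : ramp γ v ≤ 1 := by
  rw [ramp_eq_max_min hγ]; exact max_le zero_le_one (min_le_left _ _)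

theorem abs_ramp_le_one {γ : ℝ} (hγ : 0 < γ) (v : ℝ) : |ramp γ v| ≤ 1 := by
  rw [abs_of_nonneg (ramp_nonneg hγ v)]; exact ramp_le_one hγ v

theorem continuous_ramp {γ : ℝ} (hγ : 0 < γ) : Continuous (ramp γ) := by
  have : ramp γ = fun v => max 0 (min 1 (1 - v / γ)) := funext (ramp_eq_max_min hγ)
  rw [this]
  fun_prop

theorem abs_ramp_sub_ramp_le {γ : ℝ} (hγ : 0 < γ) (u v : ℝ) :
    |ramp γ u - ramp γ v| ≤ |u - v| / γ := by
  rw [ramp_eq_max_min hγ, ramp_eq_max_min hγ]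
  refine (abs_max_sub_max_le_max _ _ _ _).trans (max_le (by simp; positivity) ?_)
  refine (abs_min_sub_min_le_max _ _ _ _).trans (max_le (by simp; positivity) ?_)
  rw [show 1 - u / γ - (1 - v / γ) = -((u - v) / γ) by ring, abs_neg, abs_div, abs_of_pos hγ]

theorem ramp_eq_one_of_nonpos {γ v : ℝ} (hγ : 0 < γ) (hv : v ≤ 0) : ramp γ v = 1 := by
  have : v / γ ≤ 0 := div_nonpos_of_nonpos_of_nonneg hv hγ.le
  rw [ramp_eq_max_min hγ, min_eq_left (by linarith), max_eq_right zero_le_one]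

/-- The ramp loss is dominated by the logistic functional gradient. -/
theorem ramp_le_mul_logistic {γ : ℝ} (hγ : 0 < γ) (v : ℝ) :
    ramp γ v ≤ (1 + exp γ) * (1 / (1 + exp v)) := by
  rcases le_or_gt v γ with h | h
  · refine (ramp_le_one hγ v).trans ?_
    rw [mul_one_div, le_div_iff₀ (by positivity)]
    linarith [exp_le_exp.2 h]
  · have : ramp γ v = 0 := by
      unfold ramp
      rw [if_neg (by linarith), if_neg (by linarith)]
    rw [this]
    positivity

section Network

variable {d m n : ℕ} {σ : ℝ → ℝ} {K₁ K₂ β : ℝ}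

theorem n21_le_sqrt_mul_en2 (Θ : Fin m → EuclideanSpace ℝ (Fin d)) :
    n21 d m Θ ≤ Real.sqrt m * en2 d m Θ := by
  unfold n21 en2 nsq
  rw [← Real.sqrt_mul (Nat.cast_nonneg m)]
  refine Real.le_sqrt_of_sq_le ?_
  have := sq_sum_le_card_mul_sum_sq (s := univ) (f := fun r => ‖Θ r‖)
  simpa using this

theorem norm_le_en2 (Θ : Fin m → EuclideanSpace ℝ (Fin d)) (r : Fin m) : ‖Θ r‖ ≤ en2 d m Θ :=
  Real.le_sqrt_of_sq_le (single_le_sum (f := fun r => ‖Θ r‖ ^ 2) (fun _ _ => by positivity)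
    (mem_univ r))

theorem abs_sub_le_of_deriv_bound (hσ : ∀ z, HasDerivAt σ (deriv σ z) z)
    (h1 : ∀ z, |deriv σ z| ≤ K₁) (u v : ℝ) : |σ u - σ v| ≤ K₁ * |u - v| := by
  have := Convex.norm_image_sub_le_of_norm_hasDerivWithin_le (f := σ) (f' := deriv σ)
    (s := Set.univ) (C := K₁) (x := v) (y := u) (fun x _ => (hσ x).hasDerivWithinAt)
    (fun x _ => h1 x) convex_univ trivial trivial
  simpa using this

theorem abs_fnet_sub_fnet_le (hσ : ∀ z, HasDerivAt σ (deriv σ z) z)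
    (h1 : ∀ z, |deriv σ z| ≤ K₁) {a : Fin m → ℝ} (ha : ∀ r, |a r| = 1)
    (Θ Θ' : Fin m → EuclideanSpace ℝ (Fin d)) {x : EuclideanSpace ℝ (Fin d)} (hx : ‖x‖ ≤ 1) :
    |fnet d m β σ a Θ x - fnet d m β σ a Θ' x| ≤
      (m : ℝ) ^ (-β) * (K₁ * (Real.sqrt m * en2 d m fun r => Θ r - Θ' r)) := by
  have hK : 0 ≤ K₁ := (abs_nonneg _).trans (h1 0)
  unfold fnet
  rw [← mul_sub, ← sum_sub_distrib, abs_mul, abs_of_nonneg (by positivity)]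
  refine mul_le_mul_of_nonneg_left ?_ (by positivity)
  refine le_trans ?_ (mul_le_mul_of_nonneg_left (n21_le_sqrt_mul_en2 _) hK)
  unfold n21
  rw [mul_sum]
  refine (abs_sum_le_sum_abs _ _).trans (sum_le_sum fun r _ => ?_)
  rw [← mul_sub, abs_mul, ha, one_mul]
  refine (abs_sub_le_of_deriv_bound hσ h1 _ _).trans (mul_le_mul_of_nonneg_left ?_ hK)
  rw [← inner_sub_left]
  refine (abs_real_inner_le_norm _ _).trans ?_
  exact mul_le_of_le_one_right (norm_nonneg _) hx

/-- The Rademacher process `∑ εᵢ σ'(θᵀxᵢ) xᵢ` is bounded in norm, uniformly over a ball of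
parameters, by a random variable with controlled mean. -/
theorem exists_rademacher_gradient_bound (hn : 0 < n) (hK₁ : 0 < K₁) (hK₂ : 0 ≤ K₂)
    (h1 : ∀ z, |deriv σ z| ≤ K₁) (h2 : ∀ z w, |deriv σ z - deriv σ w| ≤ K₂ * |z - w|)
    {x : Fin n → EuclideanSpace ℝ (Fin d)} (hx : ∀ i, ‖x i‖ ≤ 1) {R L : ℝ} (hR : 0 ≤ R)
    (hL0 : 0 < L) (hL : d * Real.log (1 + 2 * R * n) + d * Real.log 5 ≤ L) :
    ∃ W : (Fin n → Bool) → ℝ, (∀ ε θ, ‖θ‖ ≤ R →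
        ‖∑ i, (boolSign (ε i) * deriv σ ⟪θ, x i⟫) • x i‖ ≤ W ε) ∧
      (1 / 2 ^ n : ℝ) * ∑ ε, W ε ≤ 2 * (K₂ + K₁ * Real.sqrt (2 * n * L)) := by
  classical
  have hnR : (0 : ℝ) < n := Nat.cast_pos.2 hn
  obtain ⟨N, hN, hNc, -, hNx⟩ := exists_finset_net (E := EuclideanSpace ℝ (Fin d)) (R := R)
    (ε := 1 / n) hR (by positivity)
  obtain ⟨U, hU, hUc, hU1, hUx⟩ := exists_finset_net (E := EuclideanSpace ℝ (Fin d)) (R := 1)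
    (ε := 1 / 2) zero_le_one (by positivity)
  rw [finrank_euclideanSpace_fin] at hNc hUc
  have hNU : (N ×ˢ U).Nonempty := hN.product hU
  set c : EuclideanSpace ℝ (Fin d) × EuclideanSpace ℝ (Fin d) → Fin n → ℝ :=
    fun p i => deriv σ ⟪p.1, x i⟫ * ⟪x i, p.2⟫ with hc
  set V : (Fin n → Bool) → EuclideanSpace ℝ (Fin d) → EuclideanSpace ℝ (Fin d) :=
    fun ε θ => ∑ i, (boolSign (ε i) * deriv σ ⟪θ, x i⟫) • x i with hV
  have hVc : ∀ ε θ u, ⟪V ε θ, u⟫ = ∑ i, boolSign (ε i) * c (θ, u) i := by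
    intro ε θ u
    rw [hV]
    simp only [sum_inner, real_inner_smul_left, hc, mul_assoc]
  have hcK : ∀ p ∈ N ×ˢ U, ∀ i, |c p i| ≤ K₁ := by
    intro p hp i
    have hp2 := hU1 _ (mem_product.1 hp).2
    rw [hc, abs_mul]
    calc _ ≤ K₁ * 1 := by
          refine mul_le_mul (h1 _) ((abs_real_inner_le_norm _ _).trans ?_) (abs_nonneg _) hK₁.le
          exact mul_le_one₀ (hx i) (norm_nonneg _) hp2
      _ = K₁ := mul_one _
  have hcard : Real.log (N ×ˢ U).card ≤ L := by
    rw [card_product, Nat.cast_mul, Real.log_mul (Nat.cast_pos.2 hN.card_pos).ne'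
      (Nat.cast_pos.2 hU.card_pos).ne']
    refine le_trans (add_le_add ?_ ?_) hL
    · rw [← Real.log_pow]
      refine Real.log_le_log (Nat.cast_pos.2 hN.card_pos) (hNc.trans (le_of_eq ?_))
      congr 1
      field_simp
    · rw [← Real.log_pow]
      refine Real.log_le_log (Nat.cast_pos.2 hU.card_pos) (hUc.trans (le_of_eq ?_))
      norm_num
  refine ⟨fun ε => 2 * (K₂ + (N ×ˢ U).sup' hNU fun p => ∑ i, boolSign (ε i) * c p i), ?_, ?_⟩
  · intro ε θ hθ
    obtain ⟨a, ha, hθa⟩ := hNx θ hθ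
    have hdiff : ‖V ε θ - V ε a‖ ≤ K₂ := by
      rw [hV]
      simp only
      rw [← sum_sub_distrib]
      refine (norm_sum_le_of_le (f := fun i => (boolSign (ε i) * deriv σ ⟪θ, x i⟫) • x i -
        (boolSign (ε i) * deriv σ ⟪a, x i⟫) • x i) univ (n := fun _ => K₂ * (1 / n))
          fun i _ => ?_).trans ?_
      · rw [← sub_smul, ← mul_sub, norm_smul, norm_mul, Real.norm_eq_abs, abs_boolSign, one_mul]
        refine (mul_le_of_le_one_right (norm_nonneg _) (hx i)).trans ((h2 _ _).trans ?_)
        refine mul_le_mul_of_nonneg_left ?_ hK₂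
        rw [← inner_sub_left]
        refine (abs_real_inner_le_norm _ _).trans ?_
        exact (mul_le_of_le_one_right (norm_nonneg _) (hx i)).trans hθa
      · rw [sum_const, card_univ, Fintype.card_fin, nsmul_eq_mul]
        apply le_of_eq
        field_simp
    obtain ⟨u, hu, hau⟩ : ∃ u ∈ U, ‖V ε θ‖ / 2 ≤ ⟪V ε θ, u⟫ := by
      obtain ⟨u, hu, h⟩ := hUx (‖V ε θ‖⁻¹ • V ε θ) (by
        rw [norm_smul, norm_inv, norm_norm]
        exact inv_mul_le_one)
      refine ⟨u, hu, ?_⟩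
      have e : ⟪V ε θ, ‖V ε θ‖⁻¹ • V ε θ⟫ = ‖V ε θ‖ := by
        rw [real_inner_smul_right, real_inner_self_eq_norm_sq]
        rcases eq_or_ne (‖V ε θ‖) 0 with h0 | h0
        · rw [h0]; simp
        · field_simp
      have e2 := real_inner_le_norm (V ε θ) (‖V ε θ‖⁻¹ • V ε θ - u)
      rw [inner_sub_right, e] at e2
      have e3 := mul_le_mul_of_nonneg_left h (norm_nonneg (V ε θ))
      linarith
    have hle : ⟪V ε a, u⟫ ≤ (N ×ˢ U).sup' hNU fun p => ∑ i, boolSign (ε i) * c p i := by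
      rw [hVc]
      exact le_sup' (fun p => ∑ i, boolSign (ε i) * c p i) (mem_product.2 ⟨ha, hu⟩)
    have hd2 : ⟪V ε θ, u⟫ - ⟪V ε a, u⟫ ≤ K₂ := by
      rw [← inner_sub_left]
      refine (real_inner_le_norm _ _).trans ?_
      exact (mul_le_of_le_one_right (norm_nonneg _) (hU1 u hu)).trans hdiff
    linarith
  · have := rademacher_finite_class_le (N ×ˢ U) hNU hn c hK₁ hL0 hcK hcard
    rw [← mul_sum, sum_add_distrib, mul_left_comm, mul_add]
    have e : (1 / 2 ^ n : ℝ) * ∑ _ε : Fin n → Bool, K₂ = K₂ := by simp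
    rw [e]
    linarith

/-- Increments of `θ ↦ ∑ cᵢ σ(θᵀxᵢ)` are controlled by its gradient on a ball. -/
theorem abs_sum_sub_le_of_gradient_bound (hσ : ∀ z, HasDerivAt σ (deriv σ z) z)
    (x : Fin n → EuclideanSpace ℝ (Fin d)) (c : Fin n → ℝ) {R W : ℝ}
    (hW : ∀ θ, ‖θ‖ ≤ R → ‖∑ i, (c i * deriv σ ⟪θ, x i⟫) • x i‖ ≤ W)
    {θ θ' : EuclideanSpace ℝ (Fin d)} (hθ : ‖θ‖ ≤ R) (hθ' : ‖θ'‖ ≤ R) :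
    |∑ i, c i * (σ ⟪θ, x i⟫ - σ ⟪θ', x i⟫)| ≤ W * ‖θ - θ'‖ := by
  have hd : ∀ s : ℝ, HasDerivAt (fun s : ℝ => ∑ i, c i * σ ⟪θ' + s • (θ - θ'), x i⟫)
      (⟪∑ i, (c i * deriv σ ⟪θ' + s • (θ - θ'), x i⟫) • x i, θ - θ'⟫) s := by
    intro s
    rw [sum_inner]
    refine HasDerivAt.fun_sum fun i _ => ?_
    rw [real_inner_smul_left, mul_assoc]
    refine HasDerivAt.const_mul _ ?_
    have h3 : HasDerivAt (fun s : ℝ => ⟪θ' + s • (θ - θ'), x i⟫) ⟪θ - θ', x i⟫ s := by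
      simp only [inner_add_left, real_inner_smul_left]
      simpa using ((hasDerivAt_id s).mul_const ⟪θ - θ', x i⟫).const_add ⟪θ', x i⟫
    rw [real_inner_comm (θ - θ') (x i)]
    exact (hσ _).comp s h3
  obtain ⟨s, hs, he⟩ := exists_hasDerivAt_eq_slope
    (fun s : ℝ => ∑ i, c i * σ ⟪θ' + s • (θ - θ'), x i⟫) _ zero_lt_one
    (fun s _ => (hd s).continuousAt.continuousWithinAt) (fun s _ => hd s)
  have hball : ‖θ' + s • (θ - θ')‖ ≤ R := by
    have := (convex_closedBall (0 : EuclideanSpace ℝ (Fin d)) R).add_smul_sub_mem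
      (x := θ') (y := θ) (by simpa using hθ') (by simpa using hθ) (Set.Ioo_subset_Icc_self hs)
    simpa using this
  have e : ∑ i, c i * (σ ⟪θ, x i⟫ - σ ⟪θ', x i⟫) =
      ⟪∑ i, (c i * deriv σ ⟪θ' + s • (θ - θ'), x i⟫) • x i, θ - θ'⟫ := by
    rw [he]
    simp [mul_sub]
  rw [e]
  exact (abs_real_inner_le_norm _ _).trans
    (mul_le_mul_of_nonneg_right (hW _ hball) (norm_nonneg _))

/-- Signed sums of network increments are controlled by the single-neuron gradient process. -/
theorem abs_sum_mul_fnet_sub_le (hσ : ∀ z, HasDerivAt σ (deriv σ z) z)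
    {a : Fin m → ℝ} (ha : ∀ r, |a r| = 1) (x : Fin n → EuclideanSpace ℝ (Fin d))
    (c : Fin n → ℝ) {B D W : ℝ}
    (hW : ∀ θ, ‖θ‖ ≤ B + D → ‖∑ i, (c i * deriv σ ⟪θ, x i⟫) • x i‖ ≤ W)
    {Θ Θ0 : Fin m → EuclideanSpace ℝ (Fin d)} (hB : ∀ r, ‖Θ0 r‖ ≤ B)
    (hD : en2 d m (fun r => Θ r - Θ0 r) ≤ D) :
    |∑ i, c i * (fnet d m β σ a Θ (x i) - fnet d m β σ a Θ0 (x i))| ≤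
      (m : ℝ) ^ (-β) * (W * (Real.sqrt m * D)) := by
  have hD0 : 0 ≤ D := (Real.sqrt_nonneg _).trans hD
  rcases Nat.eq_zero_or_pos m with rfl | hm
  · simp [fnet]
  have hB0 : 0 ≤ B := (norm_nonneg _).trans (hB ⟨0, hm⟩)
  have hW0 : 0 ≤ W := (norm_nonneg _).trans (hW 0 (by simpa using add_nonneg hB0 hD0))
  have e : ∑ i, c i * (fnet d m β σ a Θ (x i) - fnet d m β σ a Θ0 (x i)) =
      (m : ℝ) ^ (-β) * ∑ r, a r * ∑ i, c i * (σ ⟪Θ r, x i⟫ - σ ⟪Θ0 r, x i⟫) := by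
    unfold fnet
    simp only [← mul_sub, ← sum_sub_distrib]
    simp only [mul_sum]
    rw [sum_comm]
    exact sum_congr rfl fun _ _ => sum_congr rfl fun _ _ => by ring
  rw [e, abs_mul, abs_of_nonneg (by positivity)]
  refine mul_le_mul_of_nonneg_left ?_ (by positivity)
  refine le_trans ?_ (mul_le_mul_of_nonneg_left ((n21_le_sqrt_mul_en2 _).trans
    (mul_le_mul_of_nonneg_left hD (Real.sqrt_nonneg _))) hW0)
  unfold n21
  rw [mul_sum]
  refine (abs_sum_le_sum_abs _ _).trans (sum_le_sum fun r _ => ?_)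
  rw [abs_mul, ha, one_mul]
  have hr : ‖Θ r - Θ0 r‖ ≤ D := (norm_le_en2 (fun r => Θ r - Θ0 r) r).trans hD
  refine abs_sum_sub_le_of_gradient_bound hσ x c hW ?_ ((hB r).trans (by linarith))
  have := norm_add_le (Θ0 r) (Θ r - Θ0 r)
  rw [add_sub_cancel] at this
  exact this.trans (add_le_add (hB r) hr)

end Network

section UniformConvergence

variable {d m n : ℕ} {σ : ℝ → ℝ} {K₁ K₂ β : ℝ}

theorem continuous_fnet {Z : Type*} [TopologicalSpace Z] (hσ : Continuous σ) (a : Fin m → ℝ)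
    {Θ : Z → Fin m → EuclideanSpace ℝ (Fin d)} (hΘ : Continuous Θ) (x : EuclideanSpace ℝ (Fin d)) :
    Continuous fun z => fnet d m β σ a (Θ z) x := by
  unfold fnet
  fun_prop

theorem measurable_fnet {Z : Type*} [MeasurableSpace Z] (hσ : Measurable σ) (a : Fin m → ℝ)
    {Θ : Z → Fin m → EuclideanSpace ℝ (Fin d)} {X : Z → EuclideanSpace ℝ (Fin d)}
    (hΘ : ∀ r, Measurable fun z => Θ z r) (hX : Measurable X) :
    Measurable fun z => fnet d m β σ a (Θ z) (X z) := by
  unfold fnet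
  exact (Finset.measurable_sum _ fun r _ =>
    (hσ.comp ((hΘ r).inner hX)).const_mul (a r)).const_mul _

theorem integral_le_of_forall_le {Z : Type*} [MeasurableSpace Z] {μ : Measure Z}
    [IsProbabilityMeasure μ] {f : Z → ℝ} {c : ℝ} (hc : 0 ≤ c) (h : ∀ z, f z ≤ c) :
    ∫ z, f z ∂μ ≤ c := by
  by_cases hf : Integrable f μ
  · exact (integral_mono hf (integrable_const c) h).trans (by simp)
  · rw [integral_undef hf]
    exact hc

/-- Uniform deviation bound for the ramp loss over a countable family of networks around a fixed
initialization, with failure probability from bounded differences and expectation from the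
Rademacher complexity. -/
theorem measure_exists_ramp_gap_le {Z ι : Type*} [MeasurableSpace Z] [Countable ι] [Nonempty ι]
    (ν : Measure Z) [IsProbabilityMeasure ν] (hn : 0 < n)
    (hσ : ∀ z, HasDerivAt σ (deriv σ z) z) (hK₁ : 0 < K₁) (hK₂ : 0 ≤ K₂)
    (h1 : ∀ z, |deriv σ z| ≤ K₁) (h2 : ∀ z w, |deriv σ z - deriv σ w| ≤ K₂ * |z - w|)
    {a : Fin m → ℝ} (ha : ∀ r, |a r| = 1) {X : Z → EuclideanSpace ℝ (Fin d)} {Y : Z → ℝ}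
    (hX : Measurable X) (hY : Measurable Y) (hX1 : ∀ z, ‖X z‖ ≤ 1) (hY1 : ∀ z, |Y z| = 1)
    {γ B D L s : ℝ} (hγ : 0 < γ) (hBD : 0 ≤ B + D) (hL0 : 0 < L)
    (hL : d * Real.log (1 + 2 * (B + D) * n) + d * Real.log 5 ≤ L) (hs : 0 ≤ s)
    {Θ0 : Fin m → EuclideanSpace ℝ (Fin d)} (hB : ∀ r, ‖Θ0 r‖ ≤ B)
    (h0 : ∀ x, fnet d m β σ a Θ0 x = 0)
    {Θ : ι → Fin m → EuclideanSpace ℝ (Fin d)}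
    (hD : ∀ t, en2 d m (fun r => Θ t r - Θ0 r) ≤ D) :
    (Measure.pi fun _ : Fin n => ν) {S | ∃ t,
      2 / γ * ((m : ℝ) ^ (-β) * (2 * (K₂ + K₁ * Real.sqrt (2 * n * L)) * (Real.sqrt m * D))) + s
        < ∑ i, (∫ z, ramp γ (Y z * fnet d m β σ a (Θ t) (X z)) ∂ν
            - ramp γ (Y (S i) * fnet d m β σ a (Θ t) (X (S i))))} ≤
      ENNReal.ofReal (exp (-(2 * s ^ 2) / n)) := by
  have hnR : (0 : ℝ) < n := Nat.cast_pos.2 hn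
  have hσc : Continuous σ := continuous_iff_continuousAt.2 fun z => (hσ z).continuousAt
  have hfm : ∀ t, Measurable fun z => fnet d m β σ a (Θ t) (X z) := fun t =>
    measurable_fnet hσc.measurable a (fun r => measurable_const) hX
  set φ : ι → Z → ℝ := fun t z => ramp γ (Y z * fnet d m β σ a (Θ t) (X z)) with hφ
  set ψ : ι → Z → ℝ := fun t z => fnet d m β σ a (Θ t) (X z) / γ with hψ
  have hφm : ∀ t, Measurable (φ t) := fun t =>
    (continuous_ramp hγ).measurable.comp (hY.mul (hfm t))
  have hψm : ∀ t, Measurable (ψ t) := fun t => (hfm t).div_const γ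
  have hD0 : 0 ≤ D := (Real.sqrt_nonneg _).trans (hD (Classical.arbitrary ι))
  set M : ℝ := 1 + (m : ℝ) ^ (-β) * (K₁ * (Real.sqrt m * D)) / γ with hM
  have hM0 : 0 ≤ (m : ℝ) ^ (-β) * (K₁ * (Real.sqrt m * D)) / γ := by positivity
  have hφ1 : ∀ t z, |φ t z| ≤ 1 := fun t z => abs_ramp_le_one hγ _
  have hφM : ∀ t z, |φ t z| ≤ M := fun t z => (hφ1 t z).trans (by linarith)
  have hψM : ∀ t z, |ψ t z| ≤ M := by
    intro t z
    have h := abs_fnet_sub_fnet_le (β := β) hσ h1 ha (Θ t) Θ0 (hX1 z)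
    rw [h0, sub_zero] at h
    rw [hψ, abs_div, abs_of_pos hγ]
    refine le_trans (div_le_div_of_nonneg_right (h.trans ?_) hγ.le) (le_add_of_nonneg_left zero_le_one)
    have := hD t
    gcongr
  have hcon : ∀ s t z, |φ s z - φ t z| ≤ |ψ s z - ψ t z| := by
    intro s t z
    refine (abs_ramp_sub_ramp_le hγ _ _).trans (le_of_eq ?_)
    rw [← mul_sub, abs_mul, hY1, one_mul, hψ]
    simp only
    rw [← sub_div, abs_div, abs_of_pos hγ]
  have hint : ∀ t, |∫ z, φ t z ∂ν| ≤ 1 := fun t => abs_integral_le_of_abs_le (hφ1 t)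
  set F : (Fin n → Z) → ℝ := fun S => ⨆ t, (0 + ∑ i, (∫ z, φ t z ∂ν - φ t (S i))) with hF
  have hb : ∀ (S : Fin n → Z) t, |0 + ∑ i, (∫ z, φ t z ∂ν - φ t (S i))| ≤ n * 2 := by
    intro S t
    rw [zero_add]
    refine (abs_sum_le_sum_abs _ _).trans ?_
    calc _ ≤ ∑ _i : Fin n, (2 : ℝ) := sum_le_sum fun i _ => by
          refine (abs_sub _ _).trans ?_
          linarith [hint t, hφ1 t (S i)]
      _ = n * 2 := by simp
  have hFm : Measurable F := by
    refine Measurable.iSup fun t => ?_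
    refine measurable_const.add (Finset.measurable_sum _ fun i _ => ?_)
    exact measurable_const.sub ((hφm t).comp (measurable_pi_apply i))
  have hFd : ∀ i (S S' : Fin n → Z), (∀ j, j ≠ i → S j = S' j) → |F S - F S'| ≤ 1 := by
    intro i S S' h
    refine abs_ciSup_sub_ciSup_le (hb S) (hb S') fun t => ?_
    rw [add_sub_add_left_eq_sub, ← sum_sub_distrib, sum_eq_single i]
    · rw [sub_sub_sub_cancel_left, abs_le]
      have := ramp_nonneg hγ (Y (S i) * fnet d m β σ a (Θ t) (X (S i)))
      have := ramp_nonneg hγ (Y (S' i) * fnet d m β σ a (Θ t) (X (S' i)))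
      have := ramp_le_one hγ (Y (S i) * fnet d m β σ a (Θ t) (X (S i)))
      have := ramp_le_one hγ (Y (S' i) * fnet d m β σ a (Θ t) (X (S' i)))
      constructor <;> simp only [hφ] <;> linarith
    · intro j _ hj
      rw [h j hj, sub_self]
    · simp
  have hmean : ∫ S, F S ∂(Measure.pi fun _ : Fin n => ν) ≤
      2 / γ * ((m : ℝ) ^ (-β) * (2 * (K₂ + K₁ * Real.sqrt (2 * n * L)) * (Real.sqrt m * D))) := by
    refine (integral_ciSup_sum_le_rademacher ν hφm hψm hφM hψM hcon n (fun _ => 0) 0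
      (by simp)).trans ?_
    refine integral_le_of_forall_le (by positivity) fun S => ?_
    obtain ⟨W, hW, hWm⟩ := exists_rademacher_gradient_bound hn hK₁ hK₂ h1 h2
      (x := fun i => X (S i)) (fun i => hX1 _) hBD hL0 hL
    calc (1 / 2 ^ n : ℝ) * ∑ ε : Fin n → Bool, ⨆ t, (0 + ∑ i, boolSign (ε i) * (2 * ψ t (S i)))
        ≤ (1 / 2 ^ n : ℝ) * ∑ ε : Fin n → Bool,
          2 / γ * ((m : ℝ) ^ (-β) * (W ε * (Real.sqrt m * D))) := by
          refine mul_le_mul_of_nonneg_left (sum_le_sum fun ε _ => ciSup_le fun t => ?_)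
            (by positivity)
          have := (le_abs_self _).trans (abs_sum_mul_fnet_sub_le (β := β) hσ ha (fun i => X (S i))
            (fun i => boolSign (ε i)) (hW ε) hB (hD t))
          refine le_trans (le_of_eq ?_) (mul_le_mul_of_nonneg_left this (a := 2 / γ)
            (by positivity))
          rw [zero_add, mul_sum]
          refine sum_congr rfl fun i _ => ?_
          rw [h0, hψ]
          ring
      _ = 2 / γ * ((m : ℝ) ^ (-β) * (((1 / 2 ^ n : ℝ) * ∑ ε : Fin n → Bool, W ε) *
            (Real.sqrt m * D))) := by
          rw [← mul_sum, ← mul_sum, ← sum_mul]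
          ring
      _ ≤ _ := by gcongr
  have hmc := measure_add_le_of_bounded_differences ν hn hFm (fun S => abs_ciSup_le (hb S))
    one_pos hFd hs
  rw [one_pow, mul_one] at hmc
  refine (measure_mono ?_).trans hmc
  rintro S ⟨t, ht⟩
  have h3 : 0 + ∑ i, (∫ z, φ t z ∂ν - φ t (S i)) ≤ F S :=
    le_ciSup (f := fun t => 0 + ∑ i, (∫ z, φ t z ∂ν - φ t (S i)))
      (bddAbove_range_of_abs_le (hb S)) t
  rw [zero_add] at h3
  simp only [Set.mem_ofPred_eq]
  linarith

end UniformConvergence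

section SymmetricInitialization

variable {d k n : ℕ} {σ : ℝ → ℝ} {K₁ K₂ β : ℝ}

theorem sum_fin_two_mul {M : Type*} [AddCommMonoid M] (g : Fin (2 * k) → M) :
    ∑ r, g r = ∑ j : Fin k, (g ⟨j, by omega⟩ + g ⟨j + k, by omega⟩) := by
  rw [← (finCongr (two_mul k).symm).sum_comp, Fin.sum_univ_add, sum_add_distrib]
  congr 1
  refine sum_congr rfl fun j _ => congrArg g (Fin.ext ?_)
  simp [add_comm]

theorem symSigns_left (j : Fin k) : symSigns k ⟨j, by omega⟩ = 1 := by
  simp [symSigns]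

theorem symSigns_right (j : Fin k) : symSigns k ⟨j + k, by omega⟩ = -1 := by
  simp [symSigns]

theorem symInit_left (ω : Fin k → EuclideanSpace ℝ (Fin d)) (j : Fin k) :
    symInit d k ω ⟨j, by omega⟩ = ω j := by
  simp [symInit]

theorem symInit_right (ω : Fin k → EuclideanSpace ℝ (Fin d)) (j : Fin k) :
    symInit d k ω ⟨j + k, by omega⟩ = ω j := by
  simp [symInit]

theorem abs_symSigns (r : Fin (2 * k)) : |symSigns k r| = 1 := by
  unfold symSigns
  split_ifs <;> simp

theorem norm_symInit_le {B : ℝ} {ω : Fin k → EuclideanSpace ℝ (Fin d)} (h : ∀ j, ‖ω j‖ ≤ B)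
    (r : Fin (2 * k)) : ‖symInit d k ω r‖ ≤ B := by
  unfold symInit
  split_ifs <;> exact h _

theorem continuous_symInit : Continuous (symInit d k) := by
  refine continuous_pi fun r => ?_
  unfold symInit
  split_ifs <;> fun_prop

/-- The symmetric initialization makes the network vanish. -/
theorem fnet_symInit (ω : Fin k → EuclideanSpace ℝ (Fin d)) (x : EuclideanSpace ℝ (Fin d)) :
    fnet d (2 * k) β σ (symSigns k) (symInit d k ω) x = 0 := by
  unfold fnet
  rw [sum_fin_two_mul]
  simp [symSigns_left, symSigns_right, symInit_left, symInit_right]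

/-- Deviation bound, uniform over all parameters in a ball around a random symmetric
initialization of bounded norm. -/
theorem measure_prod_exists_ramp_gap_le {Z : Type*} [MeasurableSpace Z]
    (μ₀ : Measure (EuclideanSpace ℝ (Fin d))) [IsProbabilityMeasure μ₀]
    (ν : Measure Z) [IsProbabilityMeasure ν] (hn : 0 < n)
    (hσ : ∀ z, HasDerivAt σ (deriv σ z) z) (hK₁ : 0 < K₁) (hK₂ : 0 ≤ K₂)
    (h1 : ∀ z, |deriv σ z| ≤ K₁) (h2 : ∀ z w, |deriv σ z - deriv σ w| ≤ K₂ * |z - w|)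
    {X : Z → EuclideanSpace ℝ (Fin d)} {Y : Z → ℝ}
    (hX : Measurable X) (hY : Measurable Y) (hX1 : ∀ z, ‖X z‖ ≤ 1) (hY1 : ∀ z, |Y z| = 1)
    {γ B D L s : ℝ} (hγ : 0 < γ) (hD : 0 ≤ D) (hBD : 0 ≤ B + D) (hL0 : 0 < L)
    (hL : d * Real.log (1 + 2 * (B + D) * n) + d * Real.log 5 ≤ L) (hs : 0 ≤ s) :
    ((Measure.pi fun _ : Fin k => μ₀).prod (Measure.pi fun _ : Fin n => ν))
      {ω | (∀ j, ‖ω.1 j‖ ≤ B) ∧ ∃ Θ : Fin (2 * k) → EuclideanSpace ℝ (Fin d),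
        en2 d (2 * k) (fun r => Θ r - symInit d k ω.1 r) ≤ D ∧
        2 / γ * (((2 * k : ℕ) : ℝ) ^ (-β) *
            (2 * (K₂ + K₁ * Real.sqrt (2 * n * L)) * (Real.sqrt (2 * k : ℕ) * D))) + s
          < ∑ i, (∫ z, ramp γ (Y z * fnet d (2 * k) β σ (symSigns k) Θ (X z)) ∂ν
            - ramp γ (Y (ω.2 i) * fnet d (2 * k) β σ (symSigns k) Θ (X (ω.2 i))))} ≤
      ENNReal.ofReal (exp (-(2 * s ^ 2) / n)) := by
  have hσc : Continuous σ := continuous_iff_continuousAt.2 fun z => (hσ z).continuousAt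
  have hrc := continuous_ramp hγ
  set b : ℝ := 2 / γ * (((2 * k : ℕ) : ℝ) ^ (-β) *
            (2 * (K₂ + K₁ * Real.sqrt (2 * n * L)) * (Real.sqrt (2 * k : ℕ) * D))) + s with hb
  let Ball : Type := {Δ : Fin (2 * k) → EuclideanSpace ℝ (Fin d) // en2 d (2 * k) Δ ≤ D}
  have : Nonempty Ball := ⟨⟨0, by simpa [en2, nsq] using hD⟩⟩
  let Δ : ℕ → Ball := TopologicalSpace.denseSeq Ball
  let Θ : (Fin k → EuclideanSpace ℝ (Fin d)) → (Fin (2 * k) → EuclideanSpace ℝ (Fin d)) →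
      Fin (2 * k) → EuclideanSpace ℝ (Fin d) := fun ω Δ => symInit d k ω + Δ
  let G : (Fin k → EuclideanSpace ℝ (Fin d)) × (Fin n → Z) →
      (Fin (2 * k) → EuclideanSpace ℝ (Fin d)) → ℝ := fun ω Δ =>
    ∑ i, (∫ z, ramp γ (Y z * fnet d (2 * k) β σ (symSigns k) (Θ ω.1 Δ) (X z)) ∂ν
            - ramp γ (Y (ω.2 i) * fnet d (2 * k) β σ (symSigns k) (Θ ω.1 Δ) (X (ω.2 i))))
  have hmeas : ∀ Δ, Measurable fun p : (Fin k → EuclideanSpace ℝ (Fin d)) × Z =>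
      ramp γ (Y p.2 * fnet d (2 * k) β σ (symSigns k) (Θ p.1 Δ) (X p.2)) := by
    intro Δ
    refine hrc.measurable.comp ((hY.comp measurable_snd).mul
      (measurable_fnet hσc.measurable _ (fun r => ?_) (hX.comp measurable_snd)))
    exact (((continuous_apply r).comp continuous_symInit).measurable.comp
      measurable_fst).add measurable_const
  have hGm : ∀ Δ, Measurable fun ω => G ω Δ := by
    intro Δ
    refine Finset.measurable_sum _ fun i _ => Measurable.sub ?_ ?_
    · exact ((hmeas Δ).stronglyMeasurable.integral_prod_right' (ν := ν)).measurable.comp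
        measurable_fst
    · exact (hmeas Δ).comp
        (measurable_fst.prodMk ((measurable_pi_apply i).comp measurable_snd))
  have hGc : ∀ ω, Continuous (G ω) := by
    intro ω
    have hΘ : Continuous (Θ ω.1) := continuous_const.add continuous_id
    have hΔ : ∀ z, Continuous fun Δ =>
        ramp γ (Y z * fnet d (2 * k) β σ (symSigns k) (Θ ω.1 Δ) (X z)) := fun z =>
      hrc.comp (continuous_const.mul (continuous_fnet hσc _ hΘ (X z)))
    refine continuous_finsetSum _ fun i _ => Continuous.sub ?_ (hΔ _)
    refine continuous_of_dominated (bound := fun _ => 1) (fun Δ => ?_) (fun Δ => ?_)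
      (integrable_const _) (Filter.Eventually.of_forall fun z => hΔ z)
    · exact ((hmeas Δ).comp measurable_prodMk_left).aestronglyMeasurable
    · exact Filter.Eventually.of_forall fun z => abs_ramp_le_one hγ _
  have hsub : {ω : (Fin k → EuclideanSpace ℝ (Fin d)) × (Fin n → Z) |
      (∀ j, ‖ω.1 j‖ ≤ B) ∧ ∃ Θ : Fin (2 * k) → EuclideanSpace ℝ (Fin d),
        en2 d (2 * k) (fun r => Θ r - symInit d k ω.1 r) ≤ D ∧
        b < ∑ i, (∫ z, ramp γ (Y z * fnet d (2 * k) β σ (symSigns k) Θ (X z)) ∂ν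
            - ramp γ (Y (ω.2 i) * fnet d (2 * k) β σ (symSigns k) Θ (X (ω.2 i))))} ⊆
      {ω | ∀ j, ‖ω.1 j‖ ≤ B} ∩ {ω | ∃ t, b < G ω (Δ t).1} := by
    rintro ω ⟨hω, Θ', hΘ', hlt⟩
    refine ⟨hω, ?_⟩
    let Δ' : Ball := ⟨fun r => Θ' r - symInit d k ω.1 r, hΘ'⟩
    have hopen : IsOpen {Δ : Ball | b < G ω Δ.1} :=
      isOpen_lt continuous_const ((hGc ω).comp continuous_subtype_val)
    have hmem : Δ' ∈ {Δ : Ball | b < G ω Δ.1} := by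
      have e : Θ ω.1 Δ'.1 = Θ' := by
        funext r
        simp [Θ, Δ']
      simp only [Set.mem_ofPred_eq, G, e]
      exact hlt
    exact (TopologicalSpace.denseRange_denseSeq Ball).exists_mem_open hopen ⟨Δ', hmem⟩
  refine (measure_mono hsub).trans ?_
  have hms : MeasurableSet ({ω : (Fin k → EuclideanSpace ℝ (Fin d)) × (Fin n → Z) |
      ∀ j, ‖ω.1 j‖ ≤ B} ∩ {ω | ∃ t, b < G ω (Δ t).1}) := by
    refine MeasurableSet.inter ?_ ?_
    · simp only [Set.ofPred_forall]
      refine MeasurableSet.iInter fun j => measurableSet_le ?_ measurable_const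
      exact ((measurable_pi_apply j).comp measurable_fst).norm
    · simp only [Set.ofPred_exists]
      exact MeasurableSet.iUnion fun t => measurableSet_lt measurable_const (hGm _)
  rw [Measure.prod_apply hms]
  refine (lintegral_mono (g := fun _ => ENNReal.ofReal (exp (-(2 * s ^ 2) / n)))
    fun ω₁ => ?_).trans (by simp)
  by_cases hω : ∀ j, ‖ω₁ j‖ ≤ B
  · refine (measure_mono ?_).trans (measure_exists_ramp_gap_le (ι := ℕ) (β := β) ν hn hσ hK₁ hK₂
      h1 h2 abs_symSigns hX hY hX1 hY1 hγ hBD hL0 hL hs (norm_symInit_le hω)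
      (fnet_symInit ω₁) (Θ := fun t => Θ ω₁ (Δ t).1) fun t => ?_)
    · rintro S ⟨-, ht⟩
      exact ht
    · simpa [Θ] using (Δ t).2
  · refine (measure_mono (t := ∅) ?_).trans (by simp)
    rintro S ⟨h, -⟩
    exact hω h

/-- Hoeffding bound for the random-feature margin of a single data point. -/
theorem measure_margin_lt_le (μ₀ : Measure (EuclideanSpace ℝ (Fin d))) [IsProbabilityMeasure μ₀]
    (hk : 0 < k) (hK₁ : 0 < K₁) {g : EuclideanSpace ℝ (Fin d) → ℝ} (hg : Measurable g)
    (hgK : ∀ θ, |g θ| ≤ K₁) {ρ : ℝ} (hρ : 0 ≤ ρ) (hgρ : ρ ≤ ∫ θ, g θ ∂μ₀) :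
    (Measure.pi fun _ : Fin k => μ₀) {ω | ∑ j, g (ω j) < k * (ρ / 2)} ≤
      ENNReal.ofReal (exp (-(k * ρ ^ 2 / (8 * K₁ ^ 2)))) := by
  have hk' : (0 : ℝ) < k := Nat.cast_pos.2 hk
  have hmean : ∫ ω, -∑ j, g (ω j) ∂(Measure.pi fun _ : Fin k => μ₀) = -(k * ∫ θ, g θ ∂μ₀) := by
    rw [integral_neg, integral_finsetSum]
    · have : ∀ j : Fin k, ∫ ω, g (ω j) ∂(Measure.pi fun _ : Fin k => μ₀) = ∫ θ, g θ ∂μ₀ := by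
        intro j
        exact integral_comp_eval (μ := fun _ : Fin k => μ₀) (i := j)
          hg.aestronglyMeasurable
      simp [this]
    · intro j _
      exact integrable_of_measurable_of_abs_le (hg.comp (measurable_pi_apply j))
        fun ω => hgK _
  have h := measure_add_le_of_bounded_differences μ₀ hk (F := fun ω => -∑ j, g (ω j))
    (M := k * K₁) (c := 2 * K₁) (s := k * (ρ / 2))
    (Finset.measurable_sum _ fun j _ => hg.comp (measurable_pi_apply j)).neg ?_ (by positivity) ?_
    (by positivity)
  · rw [hmean] at h
    refine (measure_mono ?_).trans (h.trans (le_of_eq ?_))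
    · intro ω hω
      simp only [Set.mem_ofPred_eq] at hω ⊢
      have := mul_le_mul_of_nonneg_left hgρ hk'.le
      linarith
    · congr 2
      field_simp
      ring
  · intro ω
    rw [abs_neg]
    refine (abs_sum_le_sum_abs _ _).trans ?_
    calc _ ≤ ∑ _j : Fin k, K₁ := sum_le_sum fun j _ => hgK _
      _ = k * K₁ := by simp
  · intro i S S' hS
    rw [neg_sub_neg, ← sum_sub_distrib, sum_eq_single i]
    · refine (abs_sub _ _).trans ?_
      linarith [hgK (S i), hgK (S' i)]
    · intro j _ hj
      rw [hS j hj, sub_self]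
    · simp

/-- With high probability every sample point is separated by the random features. -/
theorem measure_prod_exists_margin_lt_le (μ₀ : Measure (EuclideanSpace ℝ (Fin d)))
    [IsProbabilityMeasure μ₀] (ν : Measure (EuclideanSpace ℝ (Fin d) × ℝ)) [IsProbabilityMeasure ν]
    (hk : 0 < k) (hK₁ : 0 < K₁) (hσ' : Continuous (deriv σ)) (h1 : ∀ z, |deriv σ z| ≤ K₁)
    {v : EuclideanSpace ℝ (Fin d) → EuclideanSpace ℝ (Fin d)} (hv : Measurable v)
    (hv1 : ∀ θ, ‖v θ‖ ≤ 1) {ρ : ℝ} (hρ : 0 ≤ ρ)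
    (hsep : ∀ᵐ p ∂ν, ‖p.1‖ ≤ 1 ∧ (p.2 = 1 ∨ p.2 = -1) ∧
          ρ ≤ p.2 * ∫ θ, deriv σ ⟪θ, p.1⟫ * ⟪p.1, v θ⟫ ∂μ₀) :
    ((Measure.pi fun _ : Fin k => μ₀).prod (Measure.pi fun _ : Fin n => ν))
      {ω | ∃ i, ∑ j, (ω.2 i).2 * (deriv σ ⟪ω.1 j, (ω.2 i).1⟫ * ⟪(ω.2 i).1, v (ω.1 j)⟫) <
        k * (ρ / 2)} ≤
      n * ENNReal.ofReal (exp (-(k * ρ ^ 2 / (8 * K₁ ^ 2)))) := by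
  rw [Set.ofPred_exists]
  refine (measure_iUnion_fintype_le _ _).trans ?_
  refine (sum_le_sum (g := fun _ : Fin n => ENNReal.ofReal (exp (-(k * ρ ^ 2 / (8 * K₁ ^ 2)))))
    fun i _ => ?_).trans (by simp)
  have hm : MeasurableSet {ω : (Fin k → EuclideanSpace ℝ (Fin d)) ×
      (Fin n → EuclideanSpace ℝ (Fin d) × ℝ) |
      ∑ j, (ω.2 i).2 * (deriv σ ⟪ω.1 j, (ω.2 i).1⟫ * ⟪(ω.2 i).1, v (ω.1 j)⟫) < k * (ρ / 2)} := by
    refine measurableSet_lt (Finset.measurable_sum _ fun j _ => ?_) measurable_const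
    have e1 : Measurable fun ω : (Fin k → EuclideanSpace ℝ (Fin d)) ×
      (Fin n → EuclideanSpace ℝ (Fin d) × ℝ) => ω.2 i :=
      (measurable_pi_apply i).comp measurable_snd
    have e2 : Measurable fun ω : (Fin k → EuclideanSpace ℝ (Fin d)) ×
      (Fin n → EuclideanSpace ℝ (Fin d) × ℝ) => ω.1 j :=
      (measurable_pi_apply j).comp measurable_fst
    exact (measurable_snd.comp e1).mul ((hσ'.measurable.comp
      (e2.inner (measurable_fst.comp e1))).mul ((measurable_fst.comp e1).inner (hv.comp e2)))
  rw [Measure.prod_apply_symm hm]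
  have hae : ∀ᵐ S ∂(Measure.pi fun _ : Fin n => ν), ‖(S i).1‖ ≤ 1 ∧ ((S i).2 = 1 ∨ (S i).2 = -1) ∧
      ρ ≤ (S i).2 * ∫ θ, deriv σ ⟪θ, (S i).1⟫ * ⟪(S i).1, v θ⟫ ∂μ₀ :=
    (measurePreserving_eval (fun _ : Fin n => ν) i).quasiMeasurePreserving.ae hsep
  refine (lintegral_mono_ae (g := fun _ => ENNReal.ofReal (exp (-(k * ρ ^ 2 / (8 * K₁ ^ 2)))))
    ?_).trans (by simp)
  filter_upwards [hae] with S ⟨hS1, hS2, hS3⟩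
  refine measure_margin_lt_le μ₀ hk hK₁
    (g := fun θ => (S i).2 * (deriv σ ⟪θ, (S i).1⟫ * ⟪(S i).1, v θ⟫)) ?_ (fun θ => ?_) hρ ?_
  · exact measurable_const.mul ((hσ'.measurable.comp (measurable_id.inner measurable_const)).mul
      (measurable_const.inner hv))
  · have hy : |(S i).2| = 1 := by rcases hS2 with h | h <;> simp [h]
    rw [abs_mul, hy, one_mul, abs_mul]
    refine (mul_le_of_le_one_right (abs_nonneg _) ?_).trans (h1 _)
    exact (abs_real_inner_le_norm _ _).trans (mul_le_one₀ hS1 (norm_nonneg _) (hv1 _))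
  · rwa [integral_const_mul]

/-- Union bound for the norms of the initial neurons. -/
theorem measure_prod_exists_le_norm_le {Z : Type*} [MeasurableSpace Z]
    (μ₀ : Measure (EuclideanSpace ℝ (Fin d))) [IsProbabilityMeasure μ₀]
    (ν : Measure Z) [IsProbabilityMeasure ν] (B : ℝ) :
    ((Measure.pi fun _ : Fin k => μ₀).prod (Measure.pi fun _ : Fin n => ν))
      {ω | ∃ j, B ≤ ‖ω.1 j‖} ≤ k * μ₀ {θ | B ≤ ‖θ‖} := by
  rw [Set.ofPred_exists]
  refine (measure_iUnion_fintype_le _ _).trans ?_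
  refine (sum_le_sum (g := fun _ : Fin k => μ₀ {θ | B ≤ ‖θ‖}) fun j _ => ?_).trans (by simp)
  have hp : MeasurePreserving (fun ω : (Fin k → EuclideanSpace ℝ (Fin d)) × (Fin n → Z) => ω.1 j)
      ((Measure.pi fun _ : Fin k => μ₀).prod (Measure.pi fun _ : Fin n => ν)) μ₀ :=
    (measurePreserving_eval (fun _ : Fin k => μ₀) j).comp measurePreserving_fst
  refine le_of_eq (hp.measure_preimage (s := {θ | B ≤ ‖θ‖}) ?_)
  exact (measurableSet_le measurable_const measurable_norm).nullMeasurableSet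

end SymmetricInitialization

/-- Quadratic upper bound for the logistic loss. -/
theorem log_one_add_exp_neg_add_le (u h : ℝ) :
    Real.log (1 + exp (-(u + h))) ≤
      Real.log (1 + exp (-u)) - 1 / (1 + exp u) * h + h ^ 2 / 8 := by
  have hd : ∀ u, HasDerivAt (fun u => Real.log (1 + exp (-u))) (-(1 / (1 + exp u))) u := by
    intro u
    have h := (((hasDerivAt_id u).neg.exp).const_add 1).log (by positivity)
    refine h.congr_deriv ?_
    simp only [id, Pi.neg_apply, exp_neg]
    field_simp
    ring
  have hd' : ∀ u, HasDerivAt (fun u => -(1 / (1 + exp u))) (exp u / (1 + exp u) ^ 2) u := by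
    intro u
    have h := ((((hasDerivAt_exp u).const_add 1).inv (by positivity)).neg)
    simp only [one_div]
    refine h.congr_deriv ?_
    field_simp
  have hL : ∀ u w : ℝ, |-(1 / (1 + exp u)) - -(1 / (1 + exp w))| ≤ 1 / 4 * |u - w| := by
    intro u w
    have := Convex.norm_image_sub_le_of_norm_hasDerivWithin_le (s := Set.univ) (C := 1 / 4)
      (x := w) (y := u) (fun x _ => (hd' x).hasDerivWithinAt) (fun x _ => ?_) convex_univ
      trivial trivial
    · simpa using this
    · rw [Real.norm_of_nonneg (by positivity), div_le_iff₀ (by positivity)]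
      nlinarith [sq_nonneg (1 - exp x)]
  have := (abs_le.1 (abs_sub_sub_mul_le_of_lipschitz_deriv hd hL u h)).2
  linarith

section GradientDescent

variable {d m n : ℕ} {σ : ℝ → ℝ} {K₁ K₂ β η : ℝ} {a : Fin m → ℝ}
  {x : Fin n → EuclideanSpace ℝ (Fin d)} {y : Fin n → ℝ}

theorem nsq_nonneg (Θ : Fin m → EuclideanSpace ℝ (Fin d)) : 0 ≤ nsq d m Θ :=
  sum_nonneg fun _ _ => sq_nonneg _

theorem sq_en2 (Θ : Fin m → EuclideanSpace ℝ (Fin d)) : en2 d m Θ ^ 2 = nsq d m Θ :=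
  Real.sq_sqrt (nsq_nonneg Θ)

theorem abs_gval (hy : ∀ i, |y i| = 1) (Θ : Fin m → EuclideanSpace ℝ (Fin d)) (i : Fin n) :
    |gval d m n β σ a x y Θ i| = 1 / (1 + exp (y i * fnet d m β σ a Θ (x i))) := by
  unfold gval
  rw [abs_div, abs_neg, hy, abs_of_pos (by positivity)]

theorem abs_gval_le_one (hy : ∀ i, |y i| = 1) (Θ : Fin m → EuclideanSpace ℝ (Fin d)) (i : Fin n) :
    |gval d m n β σ a x y Θ i| ≤ 1 := by
  rw [abs_gval hy, div_le_one (by positivity)]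
  linarith [exp_pos (y i * fnet d m β σ a Θ (x i))]

theorem eloss_nonneg (Θ : Fin m → EuclideanSpace ℝ (Fin d)) : 0 ≤ eloss d m n β σ a x y Θ :=
  mul_nonneg (by positivity) (sum_nonneg fun i _ => Real.log_nonneg (by
    linarith [exp_pos (- y i * fnet d m β σ a Θ (x i))]))

theorem sum_inner_gradL (Θ H : Fin m → EuclideanSpace ℝ (Fin d)) :
    ∑ r, ⟪gradL d m n β σ a x y Θ r, H r⟫ = (1 / n : ℝ) * ∑ i, gval d m n β σ a x y Θ i *
      ((m : ℝ) ^ (-β) * ∑ r, a r * deriv σ ⟪Θ r, x i⟫ * ⟪H r, x i⟫) := by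
  unfold gradL
  simp only [real_inner_smul_left, sum_inner]
  rw [← mul_sum, sum_comm]
  congr 1
  refine sum_congr rfl fun i _ => ?_
  rw [mul_sum, mul_sum]
  refine sum_congr rfl fun r _ => ?_
  rw [real_inner_comm (H r) (x i)]
  ring

/-- Second-order expansion of the network in its parameters. -/
theorem abs_fnet_add_sub_linear_le (hσ : ∀ z, HasDerivAt σ (deriv σ z) z) (hK₂ : 0 ≤ K₂)
    (h2 : ∀ z w, |deriv σ z - deriv σ w| ≤ K₂ * |z - w|) (ha : ∀ r, |a r| = 1)
    (Θ H : Fin m → EuclideanSpace ℝ (Fin d)) {x : EuclideanSpace ℝ (Fin d)} (hx : ‖x‖ ≤ 1) :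
    |fnet d m β σ a (fun r => Θ r + H r) x - fnet d m β σ a Θ x -
      (m : ℝ) ^ (-β) * ∑ r, a r * deriv σ ⟪Θ r, x⟫ * ⟪H r, x⟫| ≤
      (m : ℝ) ^ (-β) * (K₂ / 2 * nsq d m H) := by
  unfold fnet nsq
  rw [← mul_sub, ← mul_sub, ← sum_sub_distrib, ← sum_sub_distrib, abs_mul,
    abs_of_nonneg (by positivity)]
  refine mul_le_mul_of_nonneg_left ?_ (by positivity)
  rw [mul_sum]
  refine (abs_sum_le_sum_abs _ _).trans (sum_le_sum fun r _ => ?_)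
  rw [mul_assoc, ← mul_sub, ← mul_sub, abs_mul, ha, one_mul, inner_add_left]
  refine (abs_sub_sub_mul_le_of_lipschitz_deriv hσ h2 _ _).trans
    (mul_le_mul_of_nonneg_left ?_ (by positivity))
  rw [← sq_abs]
  refine pow_le_pow_left₀ (abs_nonneg _) ((abs_real_inner_le_norm _ _).trans ?_) 2
  exact mul_le_of_le_one_right (norm_nonneg _) hx

/-- Descent inequality for one gradient step on the logistic loss. -/
theorem eloss_step_le (hn : 0 < n) (hm : 0 < m) (hσ : ∀ z, HasDerivAt σ (deriv σ z) z)
    (hK₂ : 0 ≤ K₂)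
    (h1 : ∀ z, |deriv σ z| ≤ K₁) (h2 : ∀ z w, |deriv σ z - deriv σ w| ≤ K₂ * |z - w|)
    (ha : ∀ r, |a r| = 1) (hx : ∀ i, ‖x i‖ ≤ 1) (hy : ∀ i, |y i| = 1) (hη : 0 ≤ η)
    (hstep : η * ((m : ℝ) ^ (-β) * (K₂ / 2) + (m : ℝ) ^ (1 - 2 * β) * (K₁ ^ 2 / 8)) ≤ 3 / 4)
    (Θ : Fin m → EuclideanSpace ℝ (Fin d)) :
    eloss d m n β σ a x y (fun r => Θ r - η • gradL d m n β σ a x y Θ r) +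
      η / 4 * nsq d m (gradL d m n β σ a x y Θ) ≤ eloss d m n β σ a x y Θ := by
  have hnR : (0 : ℝ) < n := Nat.cast_pos.2 hn
  have hmR : (0 : ℝ) < m := Nat.cast_pos.2 hm
  set g := gradL d m n β σ a x y Θ with hg
  set H : Fin m → EuclideanSpace ℝ (Fin d) := fun r => -(η • g r) with hH
  have hHn : nsq d m H = η ^ 2 * nsq d m g := by
    unfold nsq
    rw [mul_sum]
    refine sum_congr rfl fun r _ => ?_
    rw [hH, norm_neg, norm_smul, mul_pow, Real.norm_eq_abs, sq_abs]
  have hΘH : (fun r => Θ r - η • g r) = fun r => Θ r + H r := by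
    funext r
    rw [hH, sub_eq_add_neg]
  set Q := (m : ℝ) ^ (-β) * (K₂ / 2 * nsq d m H) +
    (m : ℝ) ^ (1 - 2 * β) * K₁ ^ 2 * nsq d m H / 8 with hQ
  have hlin : (1 / n : ℝ) * ∑ i, gval d m n β σ a x y Θ i *
      ((m : ℝ) ^ (-β) * ∑ r, a r * deriv σ ⟪Θ r, x i⟫ * ⟪H r, x i⟫) = -(η * nsq d m g) := by
    rw [← sum_inner_gradL, ← hg]
    unfold nsq
    rw [mul_sum, ← sum_neg_distrib]
    refine sum_congr rfl fun r _ => ?_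
    rw [hH, inner_neg_right, real_inner_smul_right, real_inner_self_eq_norm_sq]
  have hsample : ∀ i, Real.log (1 + exp (- y i * fnet d m β σ a (fun r => Θ r + H r) (x i))) ≤
      Real.log (1 + exp (- y i * fnet d m β σ a Θ (x i))) + gval d m n β σ a x y Θ i *
      ((m : ℝ) ^ (-β) * ∑ r, a r * deriv σ ⟪Θ r, x i⟫ * ⟪H r, x i⟫) + Q := by
    intro i
    set f := fnet d m β σ a Θ (x i)
    set f' := fnet d m β σ a (fun r => Θ r + H r) (x i)
    have e1 := log_one_add_exp_neg_add_le (y i * f) (y i * (f' - f))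
    rw [show -(y i * f + y i * (f' - f)) = - y i * f' by ring, neg_mul_eq_neg_mul] at e1
    have e2 : 1 / (1 + exp (y i * f)) * (y i * (f' - f)) =
        -(gval d m n β σ a x y Θ i * (f' - f)) := by
      unfold gval
      ring
    have e3 := abs_fnet_add_sub_linear_le (β := β) hσ hK₂ h2 ha Θ H (hx i)
    have e4 : gval d m n β σ a x y Θ i * (f' - f - (m : ℝ) ^ (-β) *
        ∑ r, a r * deriv σ ⟪Θ r, x i⟫ * ⟪H r, x i⟫) ≤ (m : ℝ) ^ (-β) * (K₂ / 2 * nsq d m H) := by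
      refine (le_abs_self _).trans ?_
      rw [abs_mul]
      exact (mul_le_of_le_one_left (abs_nonneg _) (abs_gval_le_one hy Θ i)).trans e3
    have e5 := abs_fnet_sub_fnet_le (β := β) hσ h1 ha (fun r => Θ r + H r) Θ (hx i)
    simp only [add_sub_cancel_left] at e5
    have e6 : (y i * (f' - f)) ^ 2 ≤ (m : ℝ) ^ (1 - 2 * β) * K₁ ^ 2 * nsq d m H := by
      rw [← sq_abs, abs_mul, hy, one_mul]
      refine (pow_le_pow_left₀ (abs_nonneg _) e5 2).trans (le_of_eq ?_)
      rw [mul_pow, mul_pow, mul_pow, Real.sq_sqrt hmR.le, sq_en2, ← Real.rpow_natCast,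
        ← Real.rpow_mul hmR.le, sub_eq_add_neg, Real.rpow_add hmR, Real.rpow_one]
      rw [show -(2 * β) = -β * (2 : ℕ) by push_cast; ring]
      ring
    rw [e2] at e1
    rw [hQ]
    linarith
  have hsum := sum_le_sum fun i (_ : i ∈ univ) => hsample i
  rw [sum_add_distrib, sum_add_distrib, sum_const, card_univ, Fintype.card_fin,
    nsmul_eq_mul] at hsum
  have hmain := mul_le_mul_of_nonneg_left hsum (by positivity : (0 : ℝ) ≤ 1 / n)
  rw [mul_add, mul_add, hlin, ← mul_assoc (1 / n : ℝ) (n : ℝ), one_div_mul_cancel hnR.ne',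
    one_mul, hQ, hHn] at hmain
  rw [hΘH]
  unfold eloss
  have := mul_le_mul_of_nonneg_right hstep (mul_nonneg hη (nsq_nonneg g))
  linarith

/-- The accumulated squared gradients are controlled by the initial loss. -/
theorem eloss_gdSeq_add_sum_le (hn : 0 < n) (hm : 0 < m) (hσ : ∀ z, HasDerivAt σ (deriv σ z) z)
    (hK₂ : 0 ≤ K₂)
    (h1 : ∀ z, |deriv σ z| ≤ K₁) (h2 : ∀ z w, |deriv σ z - deriv σ w| ≤ K₂ * |z - w|)
    (ha : ∀ r, |a r| = 1) (hx : ∀ i, ‖x i‖ ≤ 1) (hy : ∀ i, |y i| = 1) (hη : 0 ≤ η)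
    (hstep : η * ((m : ℝ) ^ (-β) * (K₂ / 2) + (m : ℝ) ^ (1 - 2 * β) * (K₁ ^ 2 / 8)) ≤ 3 / 4)
    (Θ0 : Fin m → EuclideanSpace ℝ (Fin d)) (t : ℕ) :
    eloss d m n β σ a x y (gdSeq d m n β σ a x y η Θ0 t) + η / 4 *
      ∑ s ∈ range t, nsq d m (gradL d m n β σ a x y (gdSeq d m n β σ a x y η Θ0 s)) ≤
      eloss d m n β σ a x y Θ0 := by
  induction t with
  | zero => simp [gdSeq]
  | succ t ih =>
    have := eloss_step_le hn hm hσ hK₂ h1 h2 ha hx hy hη hstep (gdSeq d m n β σ a x y η Θ0 t)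
    rw [sum_range_succ, mul_add]
    simp only [gdSeq]
    linarith

theorem gdSeq_sub (Θ0 : Fin m → EuclideanSpace ℝ (Fin d)) (t : ℕ) (r : Fin m) :
    gdSeq d m n β σ a x y η Θ0 t r - Θ0 r = -(η • ∑ s ∈ range t,
      gradL d m n β σ a x y (gdSeq d m n β σ a x y η Θ0 s) r) := by
  induction t with
  | zero => simp [gdSeq]
  | succ t ih =>
    rw [sum_range_succ, smul_add, neg_add, ← ih]
    simp only [gdSeq]
    abel

theorem nsq_gdSeq_sub_le (Θ0 : Fin m → EuclideanSpace ℝ (Fin d)) (t : ℕ) :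
    nsq d m (fun r => gdSeq d m n β σ a x y η Θ0 t r - Θ0 r) ≤ η ^ 2 * (t *
      ∑ s ∈ range t, nsq d m (gradL d m n β σ a x y (gdSeq d m n β σ a x y η Θ0 s))) := by
  unfold nsq
  rw [sum_comm, mul_sum, mul_sum]
  refine sum_le_sum fun r _ => ?_
  simp only
  rw [gdSeq_sub, norm_neg, norm_smul, mul_pow, Real.norm_eq_abs, sq_abs]
  refine mul_le_mul_of_nonneg_left ?_ (sq_nonneg _)
  refine (pow_le_pow_left₀ (norm_nonneg _) (norm_sum_le _ _) 2).trans ?_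
  simpa using sq_sum_le_card_mul_sum_sq (s := range t)
    (f := fun s => ‖gradL d m n β σ a x y (gdSeq d m n β σ a x y η Θ0 s) r‖)

/-- The gradient norm dominates the `L¹` norm of the functional gradient near a separating
initialization. -/
theorem L1norm_mul_le_en2_gradL
    (h2 : ∀ z w, |deriv σ z - deriv σ w| ≤ K₂ * |z - w|) (hK₂ : 0 ≤ K₂)
    (ha : ∀ r, |a r| = 1) (hx : ∀ i, ‖x i‖ ≤ 1) (hy : ∀ i, |y i| = 1)
    {v Θ0 Θ : Fin m → EuclideanSpace ℝ (Fin d)} (hv : ∀ r, ‖v r‖ ≤ 1) {ρ : ℝ}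
    (hmargin : ∀ i, m * (ρ / 2) ≤ ∑ r, y i * (deriv σ ⟪Θ0 r, x i⟫ * ⟪x i, v r⟫))
    (hΘ : K₂ * (Real.sqrt m * en2 d m fun r => Θ r - Θ0 r) ≤ m * (3 / 8 * ρ)) :
    L1norm d m n β σ a x y Θ * ((m : ℝ) ^ (-β) * (m * (ρ / 8))) ≤
      Real.sqrt m * en2 d m (gradL d m n β σ a x y Θ) := by
  have e1 : ∑ r, ⟪gradL d m n β σ a x y Θ r, -(a r • v r)⟫ ≤
      Real.sqrt m * en2 d m (gradL d m n β σ a x y Θ) := by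
    refine le_trans (sum_le_sum fun r _ => ?_) (n21_le_sqrt_mul_en2 _)
    refine (real_inner_le_norm _ _).trans (mul_le_of_le_one_right (norm_nonneg _) ?_)
    rw [norm_neg, norm_smul, Real.norm_eq_abs, ha, one_mul]
    exact hv r
  refine le_trans ?_ e1
  rw [sum_inner_gradL]
  unfold L1norm
  rw [mul_assoc]
  refine mul_le_mul_of_nonneg_left ?_ (by positivity)
  rw [sum_mul]
  refine sum_le_sum fun i _ => ?_
  have e2 : gval d m n β σ a x y Θ i *
      ((m : ℝ) ^ (-β) * ∑ r, a r * deriv σ ⟪Θ r, x i⟫ * ⟪-(a r • v r), x i⟫) =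
      |gval d m n β σ a x y Θ i| *
      ((m : ℝ) ^ (-β) * ∑ r, y i * (deriv σ ⟪Θ r, x i⟫ * ⟪x i, v r⟫)) := by
    rw [abs_gval hy]
    unfold gval
    rw [← mul_sum, show ∑ r, a r * deriv σ ⟪Θ r, x i⟫ * ⟪-(a r • v r), x i⟫ =
      -∑ r, deriv σ ⟪Θ r, x i⟫ * ⟪x i, v r⟫ by
        rw [← sum_neg_distrib]
        refine sum_congr rfl fun r _ => ?_
        have : a r * a r = 1 := by rw [← abs_mul_abs_self, ha, one_mul]
        rw [inner_neg_left, real_inner_smul_left, real_inner_comm (v r) (x i)]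
        linear_combination (-deriv σ ⟪Θ r, x i⟫ * ⟪v r, x i⟫) * this]
    ring
  rw [e2]
  refine mul_le_mul_of_nonneg_left (mul_le_mul_of_nonneg_left ?_ (by positivity)) (abs_nonneg _)
  have e3 : |∑ r, y i * (deriv σ ⟪Θ r, x i⟫ * ⟪x i, v r⟫) -
      ∑ r, y i * (deriv σ ⟪Θ0 r, x i⟫ * ⟪x i, v r⟫)| ≤ m * (3 / 8 * ρ) := by
    refine le_trans ?_ ((mul_le_mul_of_nonneg_left (n21_le_sqrt_mul_en2 _) hK₂).trans hΘ)
    unfold n21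
    rw [← sum_sub_distrib, mul_sum]
    refine (abs_sum_le_sum_abs _ _).trans (sum_le_sum fun r _ => ?_)
    rw [← mul_sub, ← sub_mul, abs_mul, hy, one_mul, abs_mul]
    refine (mul_le_of_le_one_right (abs_nonneg _) ?_).trans ((h2 _ _).trans ?_)
    · exact (abs_real_inner_le_norm _ _).trans (mul_le_one₀ (hx i) (norm_nonneg _) (hv r))
    · refine mul_le_mul_of_nonneg_left ?_ hK₂
      rw [← inner_sub_left]
      exact (abs_real_inner_le_norm _ _).trans (mul_le_of_le_one_right (norm_nonneg _) (hx i))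
  have := (abs_le.1 e3).1
  linarith [hmargin i]

theorem four_mul_log_two_le : 4 * Real.log 2 ≤ 4 := by
  linarith [Real.log_two_lt_d9]

/-- Deterministic analysis of gradient descent: the iterates stay in a ball around the
initialization, and one of them has a small functional gradient. -/
theorem gdSeq_ball_and_exists_L1norm_le (hn : 0 < n) (hm : 0 < m)
    (hσ : ∀ z, HasDerivAt σ (deriv σ z) z) (hK₂ : 0 ≤ K₂)
    (h1 : ∀ z, |deriv σ z| ≤ K₁) (h2 : ∀ z w, |deriv σ z - deriv σ w| ≤ K₂ * |z - w|)
    (ha : ∀ r, |a r| = 1) (hx : ∀ i, ‖x i‖ ≤ 1) (hy : ∀ i, |y i| = 1) (hη : 0 < η)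
    (hstep : η * ((m : ℝ) ^ (-β) * (K₂ / 2) + (m : ℝ) ^ (1 - 2 * β) * (K₁ ^ 2 / 8)) ≤ 3 / 4)
    {v Θ0 : Fin m → EuclideanSpace ℝ (Fin d)} (hv : ∀ r, ‖v r‖ ≤ 1) {ρ : ℝ} (hρ : 0 < ρ)
    (h0 : ∀ x, fnet d m β σ a Θ0 x = 0)
    (hmargin : ∀ i, m * (ρ / 2) ≤ ∑ r, y i * (deriv σ ⟪Θ0 r, x i⟫ * ⟪x i, v r⟫))
    {T : ℕ} (hT : 0 < T) (hTm : 32 * η * K₂ ^ 2 * Real.log 2 * T ≤ m * ρ ^ 2) :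
    (∀ t < T, en2 d m (fun r => gdSeq d m n β σ a x y η Θ0 t r - Θ0 r) ≤
        2 * Real.sqrt (η * T)) ∧
    ∃ t < T, L1norm d m n β σ a x y (gdSeq d m n β σ a x y η Θ0 t) ≤
      16 * (ρ⁻¹ * (T : ℝ) ^ (-(1 / 2) : ℝ) * ((m : ℝ) ^ (β - 1 / 2) * η ^ (-(1 / 2) : ℝ))) := by
  have hmR : (0 : ℝ) < m := Nat.cast_pos.2 hm
  have hTR : (0 : ℝ) < T := Nat.cast_pos.2 hT
  have hnR : (0 : ℝ) < n := Nat.cast_pos.2 hn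
  have hL0 : eloss d m n β σ a x y Θ0 = Real.log 2 := by
    unfold eloss
    simp only [h0, mul_zero, exp_zero]
    rw [sum_const, card_univ, Fintype.card_fin, nsmul_eq_mul, ← mul_assoc,
      one_div_mul_cancel hnR.ne', one_mul]
    norm_num
  set G : ℕ → ℝ := fun s => nsq d m (gradL d m n β σ a x y (gdSeq d m n β σ a x y η Θ0 s)) with hG
  have hsum : ∀ t, η * ∑ s ∈ range t, G s ≤ 4 * Real.log 2 := by
    intro t
    have e := eloss_gdSeq_add_sum_le hn hm hσ hK₂ h1 h2 ha hx hy hη.le hstep Θ0 t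
    rw [hL0] at e
    have := eloss_nonneg (n := n) (β := β) (σ := σ) (a := a) (x := x) (y := y)
      (gdSeq d m n β σ a x y η Θ0 t)
    simp only [hG]
    linarith
  have hdist : ∀ t < T, nsq d m (fun r => gdSeq d m n β σ a x y η Θ0 t r - Θ0 r) ≤
      4 * Real.log 2 * (η * T) := by
    intro t ht
    refine (nsq_gdSeq_sub_le Θ0 t).trans ?_
    have htT : (t : ℝ) ≤ T := Nat.cast_le.2 ht.le
    calc η ^ 2 * (t * ∑ s ∈ range t, G s) = (η * ∑ s ∈ range t, G s) * (η * t) := by ring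
      _ ≤ 4 * Real.log 2 * (η * T) := by
        refine mul_le_mul (hsum t) (by gcongr) (by positivity) ?_
        have := Real.log_pos one_lt_two
        positivity
  refine ⟨fun t ht => ?_, ?_⟩
  · unfold en2
    rw [show 2 * Real.sqrt (η * T) = Real.sqrt (4 * (η * T)) by
      rw [Real.sqrt_mul (by norm_num) (η * T), show (4 : ℝ) = 2 ^ 2 by norm_num,
        Real.sqrt_sq (by norm_num)]]
    refine Real.sqrt_le_sqrt ((hdist t ht).trans ?_)
    exact mul_le_mul_of_nonneg_right four_mul_log_two_le (by positivity)
  · obtain ⟨t, ht, hGt⟩ : ∃ t ∈ range T, G t ≤ 4 / (η * T) := by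
      refine exists_le_of_sum_le (by simpa using hT.ne') ?_
      rw [sum_const, card_range, nsmul_eq_mul, show (T : ℝ) * (4 / (η * T)) = 4 / η by
        field_simp, le_div_iff₀ hη]
      linarith [hsum T, four_mul_log_two_le]
    rw [mem_range] at ht
    refine ⟨t, ht, ?_⟩
    set Θ := gdSeq d m n β σ a x y η Θ0 t with hΘ
    have hclose : K₂ * (Real.sqrt m * en2 d m fun r => Θ r - Θ0 r) ≤ m * (3 / 8 * ρ) := by
      refine abs_le_of_sq_le_sq' ?_ (by positivity) |>.2
      rw [mul_pow, mul_pow, Real.sq_sqrt hmR.le, sq_en2]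
      have e1 := mul_le_mul_of_nonneg_left (hdist t ht) (by positivity : 0 ≤ K₂ ^ 2 * m)
      have e2 := mul_le_mul_of_nonneg_left hTm hmR.le
      have e3 : 0 ≤ (m * ρ) ^ 2 := sq_nonneg _
      nlinarith
    have e1 := L1norm_mul_le_en2_gradL (β := β) h2 hK₂ ha hx hy hv hmargin hclose
    have e2 : en2 d m (gradL d m n β σ a x y Θ) ≤ 2 * (η ^ (-(1 / 2) : ℝ) * (T : ℝ) ^ (-(1 / 2) : ℝ)) := by
      refine Real.sqrt_le_iff.2 ⟨by positivity, hGt.trans (le_of_eq ?_)⟩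
      rw [mul_pow, mul_pow, ← Real.rpow_natCast, ← Real.rpow_natCast, ← Real.rpow_natCast,
        ← Real.rpow_mul hη.le, ← Real.rpow_mul hTR.le]
      norm_num
      rw [Real.rpow_neg_one, Real.rpow_neg_one]
      field_simp
    have e3 := e1.trans (mul_le_mul_of_nonneg_left e2 (Real.sqrt_nonneg _))
    have e4 : (m : ℝ) ^ (-β) * (m * (ρ / 8)) * (16 * (ρ⁻¹ * (T : ℝ) ^ (-(1 / 2) : ℝ) *
        ((m : ℝ) ^ (β - 1 / 2) * η ^ (-(1 / 2) : ℝ)))) =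
        Real.sqrt m * (2 * (η ^ (-(1 / 2) : ℝ) * (T : ℝ) ^ (-(1 / 2) : ℝ))) := by
      have : (m : ℝ) ^ (-β) * m * (m : ℝ) ^ (β - 1 / 2) = Real.sqrt m := by
        rw [Real.sqrt_eq_rpow]
        nth_rewrite 2 [← Real.rpow_one (m : ℝ)]
        rw [← Real.rpow_add hmR, ← Real.rpow_add hmR]
        congr 1
        ring
      rw [← this]
      field_simp
      ring
    rw [← e4, mul_comm (L1norm _ _ _ _ _ _ _ _ _)] at e3
    exact le_of_mul_le_mul_left e3 (by positivity)

end GradientDescent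

/-- In the regime where the optimization error is nontrivial, the step size is small enough for
the descent inequality. -/
theorem step_size_condition {m ρ K₁ K₂ β η T : ℝ} (hm : 0 < m) (hρ : 0 < ρ) (hρK : ρ ≤ K₁)
    (hK₂ : 0 < K₂) (hη : 0 < η) (hT : 0 < T) (hη4 : η ≤ 4 * m ^ (2 * β - 1) / (K₁ ^ 2 + K₂))
    (hTm : 32 * η * K₂ ^ 2 * Real.log 2 * T ≤ m * ρ ^ 2)
    (hopt : 16 * (ρ⁻¹ * T ^ (-(1 / 2) : ℝ) * (m ^ (β - 1 / 2) * η ^ (-(1 / 2) : ℝ))) ≤ 1) :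
    η * (m ^ (-β) * (K₂ / 2) + m ^ (1 - 2 * β) * (K₁ ^ 2 / 8)) ≤ 3 / 4 := by
  have hK₁ : 0 < K₁ := hρ.trans_le hρK
  have h1 : η * K₁ ^ 2 ≤ 4 * m ^ (2 * β - 1) := by
    refine le_trans ?_ ((le_div_iff₀ (by positivity)).1 hη4)
    gcongr
    linarith
  have e1 : m ^ (2 * β - 1) * m ^ (1 - 2 * β) = 1 := by
    rw [← Real.rpow_add hm]; simp
  have h2 : η * (m ^ (1 - 2 * β) * (K₁ ^ 2 / 8)) ≤ 1 / 2 := by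
    have := mul_le_mul_of_nonneg_right h1 (by positivity : 0 ≤ m ^ (1 - 2 * β))
    rw [mul_assoc 4, e1] at this
    linarith
  have e2 : T ^ (-(1 / 2) : ℝ) * T ^ (1 / 2 : ℝ) = 1 := by
    rw [← Real.rpow_add hT]; simp
  have e3 : η ^ (-(1 / 2) : ℝ) * η ^ (1 / 2 : ℝ) = 1 := by
    rw [← Real.rpow_add hη]; simp
  have h3 : 16 * m ^ (β - 1 / 2) ≤ ρ * (Real.sqrt (η * T)) := by
    have := mul_le_mul_of_nonneg_right hopt
      (by positivity : 0 ≤ ρ * (η ^ (1 / 2 : ℝ) * T ^ (1 / 2 : ℝ)))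
    rw [Real.sqrt_eq_rpow, Real.mul_rpow hη.le hT.le]
    calc 16 * m ^ (β - 1 / 2) = 16 * m ^ (β - 1 / 2) * (ρ⁻¹ * ρ) *
          (T ^ (-(1 / 2) : ℝ) * T ^ (1 / 2 : ℝ)) * (η ^ (-(1 / 2) : ℝ) * η ^ (1 / 2 : ℝ)) := by
          rw [e2, e3, inv_mul_cancel₀ hρ.ne']; ring
      _ ≤ _ := by linarith
  have h4 : 4 * K₂ * Real.sqrt (η * T) ≤ ρ * Real.sqrt m := by
    refine abs_le_of_sq_le_sq' ?_ (by positivity) |>.2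
    rw [mul_pow, mul_pow, mul_pow, Real.sq_sqrt (by positivity), Real.sq_sqrt hm.le]
    have hl : 1 / 2 ≤ Real.log 2 := by linarith [Real.log_two_gt_d9]
    have := mul_le_mul_of_nonneg_left hl (by positivity : 0 ≤ 32 * η * K₂ ^ 2 * T)
    nlinarith
  have e4 : m ^ (β - 1 / 2) = m ^ (β - 1) * Real.sqrt m := by
    rw [Real.sqrt_eq_rpow, ← Real.rpow_add hm]; congr 1; ring
  have h5 : m ^ (β - 1) * K₂ ≤ ρ ^ 2 / 64 := by
    have hs : 0 < Real.sqrt m := Real.sqrt_pos.2 hm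
    rw [e4] at h3
    have a1 := mul_le_mul_of_nonneg_left h3 hK₂.le
    have a2 := mul_le_mul_of_nonneg_left h4 hρ.le
    have : 64 * (m ^ (β - 1) * K₂) * Real.sqrt m ≤ ρ ^ 2 * Real.sqrt m := by nlinarith
    linarith [le_of_mul_le_mul_right this hs]
  have h6 : η * (m ^ (-β) * (K₂ / 2)) ≤ 1 / 4 := by
    have e5 : m ^ (2 * β - 1) * m ^ (-β) = m ^ (β - 1) := by
      rw [← Real.rpow_add hm]; congr 1; ring
    have a1 := mul_le_mul_of_nonneg_right h1 (by positivity : 0 ≤ m ^ (-β) * (K₂ / 2))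
    have a2 : K₁ ^ 2 * (η * (m ^ (-β) * (K₂ / 2))) ≤ K₁ ^ 2 * (1 / 4) := by
      have a3 : ρ ^ 2 ≤ K₁ ^ 2 := by gcongr
      calc _ = η * K₁ ^ 2 * (m ^ (-β) * (K₂ / 2)) := by ring
        _ ≤ 4 * m ^ (2 * β - 1) * (m ^ (-β) * (K₂ / 2)) := a1
        _ = 2 * (m ^ (β - 1) * K₂) := by rw [← e5]; ring
        _ ≤ _ := by linarith [sq_nonneg K₁]
    exact le_of_mul_le_mul_left a2 (by positivity)
  rw [mul_add]
  linarith

/-- The radius containing all trained neurons, in terms of the logarithmic quantities of the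
generalization bound. -/
theorem neuron_radius_le {A b k δ E : ℝ} (hA : 1 ≤ A) (hb : 0 < b) (hk : 1 ≤ k) (hδ : 0 < δ)
    (hδ1 : δ < 1) (hE : 0 ≤ E) (hX : 1 ≤ Real.log (2 * k / δ)) :
    Real.sqrt (Real.log (A * k / δ) / b) + 2 * Real.sqrt E ≤
      (2 * (Real.log A + 1) / b + 8) * (Real.log (2 * k / δ) + E) := by
  have hlA : 0 ≤ Real.log A := Real.log_nonneg hA
  set l := Real.log (2 * k / δ) with hl
  have h1 : Real.log (A * k / δ) ≤ (Real.log A + 1) * l := by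
    rw [mul_div_assoc, Real.log_mul (by positivity) (by positivity)]
    have : Real.log (k / δ) ≤ l := Real.log_le_log (by positivity) (by gcongr; linarith)
    nlinarith
  have h0 : 0 ≤ Real.log (A * k / δ) := by
    refine Real.log_nonneg ((one_le_div hδ).2 ?_)
    nlinarith
  set c := 2 * (Real.log A + 1) / b + 8 with hc
  have hc8 : 8 ≤ c := by
    have : 0 ≤ 2 * (Real.log A + 1) / b := by positivity
    linarith
  have hX1 : 1 ≤ c * (l + E) := by nlinarith
  refine abs_le_of_sq_le_sq' ?_ (by linarith) |>.2
  have h2 : 2 * (Real.log (A * k / δ) / b) + 8 * E ≤ c * (l + E) := by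
    have a1 : Real.log (A * k / δ) / b ≤ (Real.log A + 1) * l / b := by gcongr
    have a2 : 0 ≤ 2 * (Real.log A + 1) / b * E := by positivity
    have a3 : 2 * ((Real.log A + 1) * l / b) = 2 * (Real.log A + 1) / b * l := by ring
    rw [hc]
    nlinarith
  have h3 := Real.sq_sqrt (div_nonneg h0 hb.le)
  have h4 := Real.sq_sqrt hE
  nlinarith [sq_nonneg (Real.sqrt (Real.log (A * k / δ) / b) - 2 * Real.sqrt E)]

theorem log_covering_le {c n H X R : ℝ} (hc : 0 ≤ c) (hn : 1 ≤ n) (hH : 1 ≤ H) (hX : 2 ≤ X)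
    (hR0 : 0 ≤ R) (hR : R ≤ c * X) :
    1 / 2 ≤ Real.log (n * H * X) ∧ Real.log (1 + 2 * R * n) + Real.log 5 ≤
      (1 + 2 * Real.log (5 * (1 + 2 * c))) * Real.log (n * H * X) := by
  have hnH : 1 ≤ n * H := one_le_mul_of_one_le_of_one_le hn hH
  have hnHX : 2 ≤ n * H * X := by nlinarith
  have hLL : 1 / 2 ≤ Real.log (n * H * X) := by
    have := Real.log_le_log two_pos hnHX
    linarith [Real.log_two_gt_d9]
  refine ⟨hLL, ?_⟩
  have h5 : 0 ≤ Real.log (5 * (1 + 2 * c)) := Real.log_nonneg (by linarith)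
  rw [← Real.log_mul (by positivity) (by norm_num)]
  have h1 : (1 + 2 * R * n) * 5 ≤ 5 * (1 + 2 * c) * (n * H * X) := by
    have a1 : R * n ≤ c * (n * H * X) := by
      calc R * n ≤ c * X * n := by gcongr
        _ ≤ c * X * n * H := le_mul_of_one_le_right (by positivity) hH
        _ = _ := by ring
    nlinarith
  have h2 := Real.log_le_log (by positivity) h1
  rw [Real.log_mul (x := 5 * (1 + 2 * c)) (by positivity) (by positivity)] at h2
  nlinarith

theorem complexity_le {m n d p l K₁ K₂ γ β D : ℝ} (hm : 0 < m) (hn : 1 ≤ n) (hd : 1 ≤ d)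
    (hp : 1 ≤ p) (hl : 1 / 2 ≤ l) (hK₁ : 0 ≤ K₁) (hK₂ : 0 ≤ K₂) (hγ : 0 < γ) (hD : 0 ≤ D) :
    2 / γ * (m ^ (-β) * (2 * (K₂ + K₁ * Real.sqrt (2 * n * (d * p * l))) *
      (Real.sqrt m * (2 * D)))) ≤
    n * (16 * Real.sqrt (2 * p) / γ * m ^ ((1 : ℝ) / 2 - β) * D * (1 + K₁ + K₂) *
      Real.sqrt (d / n * l)) := by
  have e1 : Real.sqrt (2 * n * (d * p * l)) = n * (Real.sqrt (2 * p) * Real.sqrt (d / n * l)) := by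
    rw [← Real.sqrt_mul (by positivity), show 2 * n * (d * p * l) = n ^ 2 * (2 * p * (d / n * l)) by
      field_simp, Real.sqrt_mul (by positivity), Real.sqrt_sq (by positivity)]
  have h1 : 1 ≤ Real.sqrt (2 * n * (d * p * l)) := by
    rw [Real.one_le_sqrt]
    have a1 : 1 ≤ d * p := one_le_mul_of_one_le_of_one_le hd hp
    have a2 : 1 ≤ n * (d * p) := one_le_mul_of_one_le_of_one_le hn a1
    nlinarith
  have e2 : m ^ ((1 : ℝ) / 2 - β) = m ^ (-β) * Real.sqrt m := by
    rw [Real.sqrt_eq_rpow, ← Real.rpow_add hm]; congr 1; ring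
  set q := Real.sqrt (2 * n * (d * p * l)) with hq
  have h2 : K₂ + K₁ * q ≤ 2 * ((1 + K₁ + K₂) * q) := by nlinarith
  calc _ ≤ 2 / γ * (m ^ (-β) * (2 * (2 * ((1 + K₁ + K₂) * q)) * (Real.sqrt m * (2 * D)))) := by
        gcongr
    _ = _ := by
        rw [e1, e2]
        ring

/-- Transfer of measure bounds on exceptional sets to a lower bound on the good set. -/
theorem ofReal_one_sub_le_measure {Ω : Type*} [MeasurableSpace Ω] (P : Measure Ω)
    [IsProbabilityMeasure P] {S : Set Ω} {e : ℝ} (he : 0 ≤ e) (h : P Sᶜ ≤ ENNReal.ofReal e) :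
    ENNReal.ofReal (1 - e) ≤ P S := by
  rw [ENNReal.ofReal_sub _ he, ENNReal.ofReal_one, tsub_le_iff_right]
  calc (1 : ENNReal) = P (S ∪ Sᶜ) := by rw [Set.union_compl_self, measure_univ]
    _ ≤ P S + P Sᶜ := measure_union_le _ _
    _ ≤ _ := by gcongr

/-- The classification error is at most the expected ramp loss. -/
theorem measureReal_nonpos_le_integral_ramp {Z : Type*} [MeasurableSpace Z] (ν : Measure Z)
    [IsProbabilityMeasure ν] {γ : ℝ} (hγ : 0 < γ) {h : Z → ℝ} (hh : Measurable h) :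
    (ν {z | h z ≤ 0}).toReal ≤ ∫ z, ramp γ (h z) ∂ν := by
  have hm : Measurable fun z => ramp γ (h z) := (continuous_ramp hγ).measurable.comp hh
  have := mul_meas_ge_le_integral_of_nonneg (μ := ν) (f := fun z => ramp γ (h z))
    (Filter.Eventually.of_forall fun z => ramp_nonneg hγ _)
    (integrable_of_measurable_of_abs_le hm fun z => abs_ramp_le_one hγ _) 1
  rw [one_mul] at this
  refine le_trans (ENNReal.toReal_mono (measure_ne_top _ _) (measure_mono fun z hz => ?_)) this
  exact (ramp_eq_one_of_nonpos hγ hz).ge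

/-- On the event where the features separate the sample and the ramp loss concentrates, some
gradient descent iterate has small classification error. -/
theorem exists_classification_error_le {d n k : ℕ} {σ : ℝ → ℝ} {K₁ K₂ β γ η ρ e s : ℝ}
    {x : Fin n → EuclideanSpace ℝ (Fin d)} {y : Fin n → ℝ}
    (hn : 0 < n) (hk : 0 < k)
    (hσ : ∀ z, HasDerivAt σ (deriv σ z) z) (hK₂ : 0 ≤ K₂)
    (h1 : ∀ z, |deriv σ z| ≤ K₁) (h2 : ∀ z w, |deriv σ z - deriv σ w| ≤ K₂ * |z - w|)
    (hx : ∀ i, ‖x i‖ ≤ 1) (hy : ∀ i, |y i| = 1) (hγ : 0 < γ) (hη : 0 < η)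
    (hstep : η * ((2 * k : ℝ) ^ (-β) * (K₂ / 2) + (2 * k : ℝ) ^ (1 - 2 * β) * (K₁ ^ 2 / 8)) ≤
      3 / 4)
    {v : EuclideanSpace ℝ (Fin d) → EuclideanSpace ℝ (Fin d)} (hv : ∀ θ, ‖v θ‖ ≤ 1) (hρ : 0 < ρ)
    {ω : Fin k → EuclideanSpace ℝ (Fin d)}
    (hmargin : ∀ i, k * (ρ / 2) ≤ ∑ j, y i * (deriv σ ⟪ω j, x i⟫ * ⟪x i, v (ω j)⟫))
    {T : ℕ} (hT : 0 < T) (hTm : 32 * η * K₂ ^ 2 * Real.log 2 * T ≤ (2 * k : ℝ) * ρ ^ 2)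
    {err risk : (Fin (2 * k) → EuclideanSpace ℝ (Fin d)) → ℝ} (herr : ∀ Θ, err Θ ≤ risk Θ)
    (hgap : ∀ Θ, en2 d (2 * k) (fun r => Θ r - symInit d k ω r) ≤ 2 * Real.sqrt (η * T) →
      ∑ i, (risk Θ - ramp γ (y i * fnet d (2 * k) β σ (symSigns k) Θ (x i))) ≤ n * e + n * s) :
    ∃ t < T, err (gdSeq d (2 * k) n β σ (symSigns k) x y η (symInit d k ω) t) ≤
      (1 + exp γ) * (16 * (ρ⁻¹ * (T : ℝ) ^ (-(1 / 2) : ℝ) *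
        ((2 * k : ℝ) ^ (β - 1 / 2) * η ^ (-(1 / 2) : ℝ)))) + s + e := by
  have hnR : (0 : ℝ) < n := Nat.cast_pos.2 hn
  have hcast : ((2 * k : ℕ) : ℝ) = 2 * k := by push_cast; rfl
  obtain ⟨hball, t, ht, hL1⟩ := gdSeq_ball_and_exists_L1norm_le (m := 2 * k) (β := β)
    (a := symSigns k) (Θ0 := symInit d k ω) (v := fun r => v (symInit d k ω r)) hn (by omega) hσ hK₂
    h1 h2 abs_symSigns hx hy hη (by rwa [hcast]) (fun r => hv _) hρ (fnet_symInit ω) (fun i => by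
      rw [sum_fin_two_mul, hcast]
      simp only [symInit_left, symInit_right]
      rw [sum_add_distrib]
      linarith [hmargin i]) hT (by rwa [hcast])
  rw [hcast] at hL1
  refine ⟨t, ht, (herr _).trans ?_⟩
  set Θ := gdSeq d (2 * k) n β σ (symSigns k) x y η (symInit d k ω) t with hΘ
  have h := hgap Θ (hball t ht)
  rw [sum_sub_distrib, sum_const, card_univ, Fintype.card_fin, nsmul_eq_mul] at h
  have hramp : ∑ i, ramp γ (y i * fnet d (2 * k) β σ (symSigns k) Θ (x i)) ≤
      n * ((1 + exp γ) * L1norm d (2 * k) n β σ (symSigns k) x y Θ) := by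
    unfold L1norm
    calc _ ≤ ∑ i, (1 + exp γ) * |gval d (2 * k) n β σ (symSigns k) x y Θ i| :=
          sum_le_sum fun i _ => by
            rw [abs_gval hy]
            exact ramp_le_mul_logistic hγ _
      _ = _ := by
          rw [← mul_sum]
          field_simp
  have hL1' := mul_le_mul_of_nonneg_left hL1 (by positivity : 0 ≤ 1 + exp γ)
  have hL1n := mul_le_mul_of_nonneg_left hL1' hnR.le
  refine le_of_mul_le_mul_left ?_ hnR
  rw [mul_add, mul_add]
  linarith

theorem exp_neg_margin_le {k n K₁ ρ δ : ℝ} (hn : 0 < n) (hK₁ : 0 < K₁) (hρ : 0 < ρ) (hδ : 0 < δ)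
    (hm : 16 * K₁ ^ 2 / ρ ^ 2 * Real.log (2 * n / δ) ≤ 2 * k) :
    n * exp (-(k * ρ ^ 2 / (8 * K₁ ^ 2))) ≤ δ / 2 := by
  have h : Real.log (2 * n / δ) ≤ k * ρ ^ 2 / (8 * K₁ ^ 2) := by
    rw [le_div_iff₀ (by positivity)]
    have := mul_le_mul_of_nonneg_right hm (sq_nonneg ρ)
    rw [div_mul_eq_mul_div, div_mul_cancel₀ _ (by positivity)] at this
    linarith
  have h2 := exp_le_exp.2 (neg_le_neg h)
  rw [exp_neg (Real.log _), Real.exp_log (by positivity)] at h2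
  calc _ ≤ n * (2 * n / δ)⁻¹ := by gcongr
    _ = δ / 2 := by field_simp

theorem exp_neg_deviation_eq {n δ : ℝ} (hn : 0 < n) (hδ : 0 < δ) (hδ1 : δ < 1) :
    exp (-(2 * (n * Real.sqrt (Real.log (2 / δ) / (2 * n))) ^ 2) / n) = δ / 2 := by
  have h0 : 0 ≤ Real.log (2 / δ) := Real.log_nonneg (by rw [one_le_div hδ]; linarith)
  rw [mul_pow, Real.sq_sqrt (by positivity), show -(2 * (n ^ 2 * (Real.log (2 / δ) / (2 * n)))) / n =
    -Real.log (2 / δ) by field_simp, exp_neg, Real.exp_log (by positivity), inv_div]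

theorem mul_exp_neg_radius_le {A A' b k δ : ℝ} (hA : 0 ≤ A) (hAA : A ≤ A') (hA1 : 1 ≤ A')
    (hb : 0 < b) (hk : 1 ≤ k) (hδ : 0 < δ) (hδ1 : δ < 1) :
    0 < Real.sqrt (Real.log (A' * k / δ) / b) ∧
      k * (A * exp (-b * Real.sqrt (Real.log (A' * k / δ) / b) ^ 2)) ≤ δ := by
  have h1 : 1 < A' * k / δ := by
    rw [one_lt_div hδ]
    nlinarith
  have h0 : 0 < Real.log (A' * k / δ) := Real.log_pos h1
  refine ⟨Real.sqrt_pos.2 (by positivity), ?_⟩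
  rw [Real.sq_sqrt (by positivity), show -b * (Real.log (A' * k / δ) / b) =
    -Real.log (A' * k / δ) by field_simp, exp_neg, Real.exp_log (by positivity)]
  rw [show k * (A * (A' * k / δ)⁻¹) = A / A' * δ by field_simp]
  exact mul_le_of_le_one_left hδ.le ((div_le_one (by positivity)).2 hAA)

/-- A separability margin is at most the slope of the activation, and forces `d` to be positive. -/
theorem margin_le_and_dim_pos {d : ℕ} {σ : ℝ → ℝ} {K₁ ρ : ℝ}
    (μ₀ : Measure (EuclideanSpace ℝ (Fin d))) [IsProbabilityMeasure μ₀]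
    (ν : Measure (EuclideanSpace ℝ (Fin d) × ℝ)) [IsProbabilityMeasure ν]
    (h1 : ∀ z, |deriv σ z| ≤ K₁) (hρ : 0 < ρ)
    {v : EuclideanSpace ℝ (Fin d) → EuclideanSpace ℝ (Fin d)} (hv : ∀ θ, ‖v θ‖ ≤ 1)
    (hsep : ∀ᵐ p ∂ν, ‖p.1‖ ≤ 1 ∧ (p.2 = 1 ∨ p.2 = -1) ∧
      ρ ≤ p.2 * ∫ θ, deriv σ ⟪θ, p.1⟫ * ⟪p.1, v θ⟫ ∂μ₀) :
    ρ ≤ K₁ ∧ 0 < d := by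
  obtain ⟨p, hp1, hp2, hp3⟩ := hsep.exists
  have hK₁ : 0 ≤ K₁ := (abs_nonneg _).trans (h1 0)
  have habs : |p.2| = 1 := by rcases hp2 with h | h <;> simp [h]
  have hint : |∫ θ, deriv σ ⟪θ, p.1⟫ * ⟪p.1, v θ⟫ ∂μ₀| ≤ K₁ := by
    have := norm_integral_le_of_norm_le_const (μ := μ₀)
      (f := fun θ => deriv σ ⟪θ, p.1⟫ * ⟪p.1, v θ⟫) (C := K₁) (.of_forall fun θ => by
        rw [Real.norm_eq_abs, abs_mul]
        have h3 : |⟪p.1, v θ⟫| ≤ 1 :=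
          (abs_real_inner_le_norm _ _).trans (mul_le_one₀ hp1 (norm_nonneg _) (hv θ))
        exact (mul_le_mul (h1 _) h3 (abs_nonneg _) hK₁).trans (mul_one _).le)
    simpa using this
  refine ⟨?_, Nat.pos_of_ne_zero ?_⟩
  · refine hp3.trans ((le_abs_self _).trans ?_)
    rw [abs_mul, habs, one_mul]
    exact hint
  · rintro rfl
    have h0 : p.1 = 0 := Subsingleton.elim _ _
    simp only [h0, inner_zero_left, mul_zero, integral_zero] at hp3
    linarith

/-- A labelled point may be truncated measurably so that the domain constraints hold
everywhere. -/
theorem exists_measurable_truncation (d : ℕ) :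
    ∃ (X : EuclideanSpace ℝ (Fin d) × ℝ → EuclideanSpace ℝ (Fin d))
      (Y : EuclideanSpace ℝ (Fin d) × ℝ → ℝ), Measurable X ∧ Measurable Y ∧
      (∀ q, ‖X q‖ ≤ 1) ∧ (∀ q, |Y q| = 1) ∧
      ∀ q : EuclideanSpace ℝ (Fin d) × ℝ, ‖q.1‖ ≤ 1 → (q.2 = 1 ∨ q.2 = -1) →
        X q = q.1 ∧ Y q = q.2 := by
  classical
  refine ⟨fun q => if ‖q.1‖ ≤ 1 then q.1 else 0, fun q => if q.2 = 1 then 1 else -1, ?_, ?_,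
    ?_, ?_, ?_⟩
  · exact Measurable.ite (measurableSet_le measurable_fst.norm measurable_const) measurable_fst
      measurable_const
  · exact Measurable.ite (measurableSet_eq_fun measurable_snd measurable_const) measurable_const
      measurable_const
  · intro q
    dsimp only
    split_ifs with h
    · exact h
    · simp
  · intro q
    dsimp only
    split_ifs <;> simp
  · intro q h1 h2
    rcases h2 with h | h
    · simp [h1, h]
    · norm_num [h1, h]

/-- An almost sure property of `ν` fails for some sample point only on a null set. -/
theorem measure_prod_exists_not_eq_zero {E Z : Type*} [MeasurableSpace E] [MeasurableSpace Z]
    {k n : ℕ} (μ₀ : Measure E) [IsProbabilityMeasure μ₀]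
    (ν : Measure Z) [IsProbabilityMeasure ν] {q : Z → Prop} (hq : ∀ᵐ z ∂ν, q z) :
    ((Measure.pi fun _ : Fin k => μ₀).prod (Measure.pi fun _ : Fin n => ν))
      {ω | ∃ i, ¬ q (ω.2 i)} = 0 := by
  have h : ∀ᵐ ω ∂((Measure.pi fun _ : Fin k => μ₀).prod (Measure.pi fun _ : Fin n => ν)),
      ∀ i, q (ω.2 i) := by
    rw [ae_all_iff]
    intro i
    exact ((Measure.quasiMeasurePreserving_eval (fun _ : Fin n => ν) i).comp
      Measure.quasiMeasurePreserving_snd).ae hq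
  rw [ae_iff] at h
  simpa only [not_forall] using h

theorem measure_le_of_subset_union {Ω : Type*} [MeasurableSpace Ω] (P : Measure Ω)
    {S N₀ N₁ N₂ N₃ : Set Ω} {δ : ℝ} (hδ : 0 ≤ δ) (h0 : P N₀ = 0)
    (h1 : P N₁ ≤ ENNReal.ofReal δ) (h2 : P N₂ ≤ ENNReal.ofReal (δ / 2))
    (h3 : P N₃ ≤ ENNReal.ofReal (δ / 2)) (hS : S ⊆ N₀ ∪ N₁ ∪ N₂ ∪ N₃) :
    P S ≤ ENNReal.ofReal (3 * δ) := by
  calc P S ≤ P N₀ + P N₁ + P N₂ + P N₃ :=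
        (measure_mono hS).trans ((measure_union_le _ _).trans (add_le_add_left
          ((measure_union_le _ _).trans (add_le_add_left (measure_union_le _ _) _)) _))
    _ ≤ 0 + ENNReal.ofReal δ + ENNReal.ofReal (δ / 2) + ENNReal.ofReal (δ / 2) := by
        gcongr
        exact h0.le
    _ = ENNReal.ofReal (2 * δ) := by
        rw [zero_add, ← ENNReal.ofReal_add hδ (by positivity),
          ← ENNReal.ofReal_add (by positivity) (by positivity)]
        congr 1
        ring
    _ ≤ ENNReal.ofReal (3 * δ) := ENNReal.ofReal_le_ofReal (by linarith)

/-- The generalization bound in the regime where the step size condition holds. -/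
theorem generalization_bound_of_step_size {A A' b : ℝ} (hA : 0 < A) (hAA : A ≤ A') (hA1 : 1 ≤ A')
    (hb : 0 < b) {p : ℝ}
    (hp : p = 1 + 2 * Real.log (5 * (1 + 2 * (2 * (Real.log A' + 1) / b + 8))))
    {d n k : ℕ} (hd : 0 < d) (hk : 0 < k) (hn : 0 < n) {σ : ℝ → ℝ} {K₁ K₂ β γ η ρ δ : ℝ}
    (hσ : ∀ z, HasDerivAt σ (deriv σ z) z) (hσ' : Continuous (deriv σ))
    (hK₁ : 0 < K₁) (hK₂ : 0 ≤ K₂)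
    (h1 : ∀ z, |deriv σ z| ≤ K₁) (h2 : ∀ z w, |deriv σ z - deriv σ w| ≤ K₂ * |z - w|)
    (μ₀ : Measure (EuclideanSpace ℝ (Fin d))) [IsProbabilityMeasure μ₀]
    (hμ₀ : ∀ t : ℝ, 0 < t → μ₀ {θ | t ≤ ‖θ‖} ≤ ENNReal.ofReal (A * Real.exp (-b * t ^ 2)))
    (ν : Measure (EuclideanSpace ℝ (Fin d) × ℝ)) [IsProbabilityMeasure ν] (hρ : 0 < ρ)
    {v : EuclideanSpace ℝ (Fin d) → EuclideanSpace ℝ (Fin d)} (hvm : Measurable v)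
    (hv : ∀ θ, ‖v θ‖ ≤ 1)
    (hsep : ∀ᵐ p ∂ν, ‖p.1‖ ≤ 1 ∧ (p.2 = 1 ∨ p.2 = -1) ∧
      ρ ≤ p.2 * ∫ θ, deriv σ ⟪θ, p.1⟫ * ⟪p.1, v θ⟫ ∂μ₀)
    (hγ : 0 < γ) (hδ : 0 < δ) (hδ1 : δ < 1)
    (hm : 16 * K₁ ^ 2 / ρ ^ 2 * Real.log (2 * n / δ) ≤ (2 * k : ℝ))
    (hlog : 2 ≤ Real.log ((2 * k : ℝ) / δ)) (hη : 0 < η)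
    (hstep : η * ((2 * k : ℝ) ^ (-β) * (K₂ / 2) + (2 * k : ℝ) ^ (1 - 2 * β) * (K₁ ^ 2 / 8)) ≤
      3 / 4)
    {T : ℕ} (hT : 0 < T) (hTm : 32 * η * K₂ ^ 2 * Real.log 2 * T ≤ (2 * k : ℝ) * ρ ^ 2) :
    ENNReal.ofReal (1 - 3 * δ) ≤
      ((Measure.pi fun _ : Fin k => μ₀).prod (Measure.pi fun _ : Fin n => ν))
        {ω | ∃ t < T,
          (ν {p | p.2 * fnet d (2 * k) β σ (symSigns k)
              (gdSeq d (2 * k) n β σ (symSigns k)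
                (fun i => (ω.2 i).1) (fun i => (ω.2 i).2) η (symInit d k ω.1) t)
              p.1 ≤ 0}).toReal ≤
            (1 + Real.exp γ) * (16 * (ρ⁻¹ * (T : ℝ) ^ (-(1 / 2) : ℝ) *
              ((2 * k : ℝ) ^ (β - 1 / 2) * η ^ (-(1 / 2) : ℝ))))
            + Real.sqrt (Real.log (2 / δ) / (2 * n))
            + 16 * Real.sqrt (2 * p) / γ * (2 * k : ℝ) ^ ((1 : ℝ) / 2 - β) * Real.sqrt (η * T) *
                (1 + K₁ + K₂) *
                Real.sqrt ((d / n : ℝ) *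
                  Real.log ((n : ℝ) * (1 + K₁ + K₂) *
                    (Real.log ((2 * k : ℝ) / δ) + Real.sqrt (η * T) ^ 2)))} := by
  have hnR : (0 : ℝ) < n := Nat.cast_pos.2 hn
  have hn1 : (1 : ℝ) ≤ n := Nat.one_le_cast.2 hn
  have hd1 : (1 : ℝ) ≤ d := Nat.one_le_cast.2 hd
  have hk1 : (1 : ℝ) ≤ k := Nat.one_le_cast.2 hk
  have hE : 0 ≤ η * T := by positivity
  have hcast : ((2 * k : ℕ) : ℝ) = 2 * k := by push_cast; rfl
  obtain ⟨X, Y, hX, hY, hX1, hY1, hXY⟩ := exists_measurable_truncation d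
  have hσm : Measurable σ :=
    (continuous_iff_continuousAt.2 fun z => (hσ z).continuousAt).measurable
  set c : ℝ := 2 * (Real.log A' + 1) / b + 8 with hc
  have hc0 : 0 ≤ c := by have := Real.log_nonneg hA1; positivity
  have hp1 : 1 ≤ p := by
    have : 0 ≤ Real.log (5 * (1 + 2 * c)) := Real.log_nonneg (by linarith)
    linarith
  set B : ℝ := Real.sqrt (Real.log (A' * k / δ) / b) with hB
  obtain ⟨hBpos, hBδ⟩ := mul_exp_neg_radius_le hA.le hAA hA1 hb hk1 hδ hδ1
  rw [← hB] at hBpos hBδ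
  have hR := neuron_radius_le hA1 hb hk1 hδ hδ1 hE (by linarith)
  rw [← hB, ← hc] at hR
  rw [Real.sq_sqrt hE]
  set ℓ : ℝ := Real.log ((n : ℝ) * (1 + K₁ + K₂) * (Real.log ((2 * k : ℝ) / δ) + η * T)) with hℓ
  obtain ⟨hℓ1, hcov⟩ := log_covering_le hc0 hn1 (H := 1 + K₁ + K₂) (by linarith)
    (X := Real.log ((2 * k : ℝ) / δ) + η * T) (by linarith)
    (R := B + 2 * Real.sqrt (η * T)) (by positivity) hR
  rw [← hp, ← hℓ] at hcov
  rw [← hℓ] at hℓ1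
  set s : ℝ := Real.sqrt (Real.log (2 / δ) / (2 * n)) with hs
  have hcomp := complexity_le (m := 2 * k) (n := n) (d := d) (β := β) (by positivity) hn1 hd1 hp1
    hℓ1 hK₁.le hK₂ hγ (Real.sqrt_nonneg (η * T))
  set e : ℝ := 16 * Real.sqrt (2 * p) / γ * (2 * k : ℝ) ^ ((1 : ℝ) / 2 - β) * Real.sqrt (η * T) *
    (1 + K₁ + K₂) * Real.sqrt ((d / n : ℝ) * ℓ) with he
  set P := (Measure.pi fun _ : Fin k => μ₀).prod (Measure.pi fun _ : Fin n => ν) with hP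
  have hgapP := measure_prod_exists_ramp_gap_le (k := k) (β := β) (L := d * p * ℓ) (B := B)
    (D := 2 * Real.sqrt (η * T)) (s := n * s) μ₀ ν hn hσ hK₁ hK₂ h1 h2 hX hY hX1 hY1 hγ
    (by positivity) (by positivity) (by positivity)
    (by
      rw [← mul_add, mul_assoc (d : ℝ) p ℓ]
      exact mul_le_mul_of_nonneg_left hcov d.cast_nonneg)
    (by positivity)
  rw [exp_neg_deviation_eq hnR hδ hδ1, hcast, ← hP] at hgapP
  have hmargP := measure_prod_exists_margin_lt_le (n := n) μ₀ ν hk hK₁ hσ' h1 hvm hv hρ.le hsep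
  have hmδ := exp_neg_margin_le hnR hK₁ hρ hδ hm
  have hnormP := measure_prod_exists_le_norm_le (k := k) (n := n) μ₀ ν B
  have hnullP := measure_prod_exists_not_eq_zero (k := k) (n := n) μ₀ ν
    (hsep.mono fun q hq => (⟨hq.1, hq.2.1⟩ : ‖q.1‖ ≤ 1 ∧ (q.2 = 1 ∨ q.2 = -1)))
  rw [← hP] at hmargP hnormP hnullP
  have hnormP' : P {ω | ∃ j, B ≤ ‖ω.1 j‖} ≤ ENNReal.ofReal δ := by
    refine hnormP.trans ((mul_le_mul_right (hμ₀ B hBpos) _).trans ?_)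
    rw [← ENNReal.ofReal_natCast, ← ENNReal.ofReal_mul (by positivity)]
    exact ENNReal.ofReal_le_ofReal hBδ
  have hmargδ : (n : ENNReal) * ENNReal.ofReal (Real.exp (-(k * ρ ^ 2 / (8 * K₁ ^ 2)))) ≤
      ENNReal.ofReal (δ / 2) := by
    rw [← ENNReal.ofReal_natCast, ← ENNReal.ofReal_mul (by positivity)]
    exact ENNReal.ofReal_le_ofReal hmδ
  refine ofReal_one_sub_le_measure P (by positivity)
    (measure_le_of_subset_union P hδ.le hnullP hnormP' (hmargP.trans hmargδ) hgapP ?_)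
  intro ω hω
  by_contra hcon
  simp only [Set.mem_union, not_or] at hcon
  obtain ⟨⟨⟨hN, hnorm⟩, hmarg⟩, hgap⟩ := hcon
  have hgood : ∀ i, ‖(ω.2 i).1‖ ≤ 1 ∧ ((ω.2 i).2 = 1 ∨ (ω.2 i).2 = -1) := by
    intro i
    by_contra h
    exact hN ⟨i, h⟩
  refine hω (exists_classification_error_le (x := fun i => (ω.2 i).1) (y := fun i => (ω.2 i).2)
    (err := fun Θ => (ν {p | p.2 * fnet d (2 * k) β σ (symSigns k) Θ p.1 ≤ 0}).toReal)
    (risk := fun Θ => ∫ z, ramp γ (Y z * fnet d (2 * k) β σ (symSigns k) Θ (X z)) ∂ν)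
    hn hk hσ hK₂ h1 h2 (fun i => (hgood i).1) ?_ hγ hη hstep hv hρ ?_ hT hTm ?_ ?_)
  · intro i
    rcases (hgood i).2 with h | h <;> simp [h]
  · intro i
    by_contra h
    exact hmarg ⟨i, not_le.1 h⟩
  · intro Θ
    have hae : (ν {p | p.2 * fnet d (2 * k) β σ (symSigns k) Θ p.1 ≤ 0}) =
        ν {z | Y z * fnet d (2 * k) β σ (symSigns k) Θ (X z) ≤ 0} := by
      refine measure_congr ?_
      filter_upwards [hsep] with q hq
      obtain ⟨hXq, hYq⟩ := hXY q hq.1 hq.2.1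
      refine propext ?_
      change q.2 * fnet d (2 * k) β σ (symSigns k) Θ q.1 ≤ 0 ↔
        Y q * fnet d (2 * k) β σ (symSigns k) Θ (X q) ≤ 0
      rw [hXq, hYq]
    rw [hae]
    exact measureReal_nonpos_le_integral_ramp ν hγ
      (hY.mul (measurable_fnet hσm _ (Θ := fun _ => Θ) (fun _ => measurable_const) hX))
  · intro Θ hΘ
    by_contra h
    refine hgap ⟨fun j => le_of_lt ?_, Θ, hΘ, ?_⟩
    · by_contra hj
      exact hnorm ⟨j, not_lt.1 hj⟩
    · refine lt_of_le_of_lt (add_le_add_left hcomp _) ((not_le.1 h).trans_le (le_of_eq ?_))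
      refine Finset.sum_congr rfl fun i _ => ?_
      obtain ⟨hXq, hYq⟩ := hXY (ω.2 i) (hgood i).1 (hgood i).2
      rw [hXq, hYq]

/-- Theorem 4, generalization bound, first form. -/
theorem generalization_bound (A b : ℝ) (hA : 0 < A) (hb : 0 < b) :
    ∃ C : ℝ, 0 < C ∧
      ∀ (d n k : ℕ), 0 < k → 0 < n →
      ∀ (σ : ℝ → ℝ) (K₁ K₂ : ℝ),
        ContDiff ℝ 2 σ →
        (∀ z, |deriv σ z| ≤ K₁) →
        (∀ z, |deriv (deriv σ) z| ≤ K₂) →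
      ∀ (μ₀ : Measure (EuclideanSpace ℝ (Fin d))), IsProbabilityMeasure μ₀ →
        (∀ t : ℝ, 0 < t → μ₀ {θ | t ≤ ‖θ‖} ≤ ENNReal.ofReal (A * Real.exp (-b * t ^ 2))) →
      ∀ (ν : Measure (EuclideanSpace ℝ (Fin d) × ℝ)), IsProbabilityMeasure ν →
      ∀ (ρ : ℝ), 0 < ρ →
      ∀ (v : EuclideanSpace ℝ (Fin d) → EuclideanSpace ℝ (Fin d)),
        Measurable v → (∀ θ, ‖v θ‖ ≤ 1) →
        (∀ᵐ p ∂ν, ‖p.1‖ ≤ 1 ∧ (p.2 = 1 ∨ p.2 = -1) ∧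
          ρ ≤ p.2 * ∫ θ, deriv σ ⟪θ, p.1⟫ * ⟪p.1, v θ⟫ ∂μ₀) →
      ∀ (β γ δ η : ℝ), 0 ≤ β → β < 1 → 0 < γ → 0 < δ → δ < 1 →
        16 * K₁ ^ 2 / ρ ^ 2 * Real.log (2 * n / δ) ≤ (2 * k : ℝ) →
        0 < η →
        η ≤ min ((2 * k : ℝ) ^ β) (4 * (2 * k : ℝ) ^ (2 * β - 1) / (K₁ ^ 2 + K₂)) →
      ∀ (T : ℕ), 0 < T →
        (T : ℝ) ≤ (2 * k : ℝ) * ρ ^ 2 / (32 * η * K₂ ^ 2 * Real.log 2) →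
      ENNReal.ofReal (1 - 3 * δ) ≤
        ((Measure.pi fun _ : Fin k => μ₀).prod (Measure.pi fun _ : Fin n => ν))
          {ω | ∃ t < T,
            (ν {p | p.2 * fnet d (2 * k) β σ (symSigns k)
                (gdSeq d (2 * k) n β σ (symSigns k)
                  (fun i => (ω.2 i).1) (fun i => (ω.2 i).2) η (symInit d k ω.1) t)
                p.1 ≤ 0}).toReal
            ≤ C * (1 + Real.exp γ) *
                (ρ⁻¹ * (T : ℝ) ^ (-(1 / 2) : ℝ) *
                  ((2 * k : ℝ) ^ (β - 1 / 2) * η ^ (-(1 / 2) : ℝ) +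
                    Real.sqrt (K₁ ^ 4 + 2 * K₁ ^ 2 * K₂ + K₁ ^ 4 * K₂ ^ 2)))
              + 3 * Real.sqrt (Real.log (2 / δ) / (2 * n))
              + C / γ * (2 * k : ℝ) ^ ((1 : ℝ) / 2 - β) * Real.sqrt (η * T) *
                  (1 + K₁ + K₂) *
                  Real.sqrt ((d / n : ℝ) *
                    Real.log ((n : ℝ) * (1 + K₁ + K₂) *
                      (Real.log ((2 * k : ℝ) / δ) + Real.sqrt (η * T) ^ 2)))} := by
  set A' : ℝ := max A 1 with hA'
  have hA1 : 1 ≤ A' := le_max_right _ _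
  set p : ℝ := 1 + 2 * Real.log (5 * (1 + 2 * (2 * (Real.log A' + 1) / b + 8))) with hp
  refine ⟨16 + 16 * Real.sqrt (2 * p), by positivity, ?_⟩
  intro d n k hk hn σ K₁ K₂ hσ2 h1 hd2 μ₀ _ hμ₀ ν _ ρ hρ v hvm hv hsep β γ δ η hβ hβ1 hγ hδ hδ1 hm
    hη hηm T hT hTm
  obtain ⟨hρK, hd⟩ := margin_le_and_dim_pos μ₀ ν h1 hρ hv hsep
  have hK₁ : 0 < K₁ := hρ.trans_le hρK
  have hσ1 : ContDiff ℝ (1 + 1) σ := by simpa [one_add_one_eq_two] using hσ2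
  have hσ' : ContDiff ℝ 1 (deriv σ) := (contDiff_succ_iff_deriv.1 hσ1).2.2
  have hσd : ∀ z, HasDerivAt σ (deriv σ z) z := fun z =>
    (hσ2.differentiable (by norm_num) z).hasDerivAt
  have h2 : ∀ z w, |deriv σ z - deriv σ w| ≤ K₂ * |z - w| := abs_sub_le_of_deriv_bound
    (fun z => (hσ'.differentiable (by norm_num) z).hasDerivAt) hd2
  have hkR : (0 : ℝ) < k := Nat.cast_pos.2 hk
  have hTR : (0 : ℝ) < T := Nat.cast_pos.2 hT
  have hK₂ : 0 < K₂ := by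
    refine lt_of_le_of_ne ((abs_nonneg _).trans (hd2 0)) ?_
    rintro rfl
    norm_num at hTm
    omega
  have hTm' : 32 * η * K₂ ^ 2 * Real.log 2 * T ≤ (2 * k : ℝ) * ρ ^ 2 := by
    have hlog2 := Real.log_pos one_lt_two
    rw [le_div_iff₀ (by positivity)] at hTm
    linarith
  have hlog : 2 ≤ Real.log ((2 * k : ℝ) / δ) := by
    have hl2 := Real.log_two_gt_d9
    have h16 : 16 * Real.log 2 ≤ 2 * k := by
      refine le_trans (mul_le_mul ?_ (Real.log_le_log two_pos ?_) (by linarith) (by positivity)) hm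
      · rw [le_div_iff₀ (by positivity)]
        nlinarith
      · rw [le_div_iff₀ hδ]
        have : (1 : ℝ) ≤ n := Nat.one_le_cast.2 hn
        nlinarith
    calc (2 : ℝ) ≤ 3 * Real.log 2 := by linarith
      _ = Real.log (2 ^ 3) := by rw [Real.log_pow]; norm_num
      _ ≤ Real.log ((2 * k : ℝ) / δ) := by
        refine Real.log_le_log (by norm_num) ?_
        rw [le_div_iff₀ hδ]
        nlinarith
  generalize hS : Real.sqrt (K₁ ^ 4 + 2 * K₁ ^ 2 * K₂ + K₁ ^ 4 * K₂ ^ 2) = S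
  have hS0 : 0 ≤ S := hS ▸ Real.sqrt_nonneg _
  set F : ℝ := (T : ℝ) ^ (-(1 / 2) : ℝ) with hF
  set G : ℝ := (2 * k : ℝ) ^ (β - 1 / 2) * η ^ (-(1 / 2) : ℝ) with hG
  have hF0 : 0 ≤ F := by positivity
  have hG0 : 0 ≤ G := by positivity
  set s : ℝ := Real.sqrt (Real.log (2 / δ) / (2 * n)) with hs
  have hs0 : 0 ≤ s := Real.sqrt_nonneg _
  set R : ℝ := Real.sqrt ((d / n : ℝ) * Real.log ((n : ℝ) * (1 + K₁ + K₂) *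
    (Real.log ((2 * k : ℝ) / δ) + Real.sqrt (η * T) ^ 2))) with hR
  set W : ℝ := (2 * k : ℝ) ^ ((1 : ℝ) / 2 - β) with hW
  have hlead : (1 + Real.exp γ) * (16 * (ρ⁻¹ * F * G)) ≤
      (16 + 16 * Real.sqrt (2 * p)) * (1 + Real.exp γ) * (ρ⁻¹ * F * (G + S)) := by
    calc (1 + Real.exp γ) * (16 * (ρ⁻¹ * F * G))
        = 16 * (1 + Real.exp γ) * (ρ⁻¹ * F * G) := by ring
      _ ≤ _ := by
        gcongr
        · linarith [Real.sqrt_nonneg (2 * p)]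
        · linarith
  have htail : 16 * Real.sqrt (2 * p) / γ * W * Real.sqrt (η * T) * (1 + K₁ + K₂) * R ≤
      (16 + 16 * Real.sqrt (2 * p)) / γ * W * Real.sqrt (η * T) * (1 + K₁ + K₂) * R := by
    gcongr
    linarith
  have htail0 : 0 ≤ 16 * Real.sqrt (2 * p) / γ * W * Real.sqrt (η * T) * (1 + K₁ + K₂) * R := by
    positivity
  by_cases hbig : 16 * (ρ⁻¹ * F * G) ≤ 1
  · have hstep := step_size_condition (m := 2 * k) (β := β) (by positivity) hρ hρK hK₂ hη hTR
      (hηm.trans (min_le_right _ _)) hTm' hbig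
    refine (generalization_bound_of_step_size hA (le_max_left A 1) hA1 hb hp hd hk hn hσd
      hσ'.continuous hK₁ hK₂.le h1 h2 μ₀ hμ₀ ν hρ hvm hv hsep hγ hδ hδ1 hm hlog hη hstep hT
      hTm').trans (measure_mono ?_)
    rintro ω ⟨t, ht, h⟩
    refine ⟨t, ht, h.trans ?_⟩
    linarith
  · have huniv : ∀ c : ℝ, 1 ≤ c → ∀ f : ((Fin k → EuclideanSpace ℝ (Fin d)) ×
        (Fin n → EuclideanSpace ℝ (Fin d) × ℝ)) → ℕ → Set (EuclideanSpace ℝ (Fin d) × ℝ),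
        {ω | ∃ t < T, (ν (f ω t)).toReal ≤ c} = Set.univ := fun c hc f =>
      Set.eq_univ_of_forall fun ω => ⟨0, hT, measureReal_le_one.trans hc⟩
    have hone : 1 ≤ (1 + Real.exp γ) * (16 * (ρ⁻¹ * F * G)) := by
      nlinarith [Real.exp_pos γ, not_le.1 hbig]
    rw [huniv _ (by linarith), measure_univ]
    exact ENNReal.ofReal_le_one.2 (by linarith)
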